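/- arXiv:1210.7254 — 4 statements merged into one kernel-verified Lean document; each statement's English description precedes it below -/
import Mathlib

section
/- Let (G,S) be a Coxeter system, A a Z[G]-module, T ∈ I(S), and s, s' distinct elements of S∖T such that T∪{s,s'} ∈ I(S). Then for every a ∈ A^{⟨T⟩}, one has d_{T∪{s},s'}(d_{T,s}(a)) + d_{T∪{s'},s}(d_{T,s'}(a)) = 0; consequently the differential of the Coxeter cochain complex satisfies d^{k+1} ∘ d^k = 0. -/
set_option linter.unusedSectionVars false

open Finset

section CoxeterCochain

variable {B : Type*} [DecidableEq B] [Fintype B]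
variable {W : Type*} [Group W] {M : CoxeterMatrix B} (cs : CoxeterSystem M W)

/-- A subset `T` of the generating set is *independent* if the corresponding simple
reflections pairwise commute. -/
def Indep (T : Finset B) : Prop :=
  ∀ i ∈ T, ∀ j ∈ T, i ≠ j → Commute (cs.simple i) (cs.simple j)

lemma Indep.mono {T T' : Finset B} (hT : Indep cs T) (h : T' ⊆ T) : Indep cs T' :=
  fun i hi j hj hij => hT i (h hi) j (h hj) hij

variable (R : Type*) [CommRing R] (A : Type*) [AddCommGroup A] [Module R A]
  [DistribMulAction W A] [SMulCommClass W R A]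

/-- The submodule of invariants `A^{⟨T⟩}` of the subgroup generated by the
simple reflections indexed by `T`. -/
def invSub (T : Finset B) : Submodule R A where
  carrier := {a | ∀ i ∈ T, cs.simple i • a = a}
  add_mem' ha hb := fun i hi => by rw [smul_add, ha i hi, hb i hi]
  zero_mem' := fun i hi => smul_zero _
  smul_mem' r a ha := fun i hi => by rw [smul_comm, ha i hi]

lemma mem_invSub {T : Finset B} {a : A} :
    a ∈ invSub cs R A T ↔ ∀ i ∈ T, cs.simple i • a = a := Iff.rfl

/-- The degree `k` part of the Coxeter cochain complex: the direct sum (= product, as the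
index set is finite) over all independent `k`-element subsets `T` of the invariants `A^{⟨T⟩}`. -/
abbrev Xc (k : ℕ) : Type _ :=
  ∀ T : {T : Finset B // Indep cs T ∧ T.card = k}, invSub cs R A T.1

/-- The sign `(-1)^{#{t ∈ T | t < s}}` (with respect to a chosen linear order on `B`). -/
def csgn (o : LinearOrder B) (T : Finset B) (s : B) : ℤ :=
  letI := o
  (-1) ^ (T.filter (fun t => t < s)).card

lemma step_mem {T : Finset B} (hT : Indep cs T) {s : B} (hs : s ∈ T) {a : A}
    (ha : a ∈ invSub cs R A (T.erase s)) :
    a + cs.simple s • a ∈ invSub cs R A T := by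
  intro i hi
  rcases eq_or_ne i s with rfl | h
  · rw [smul_add, smul_smul, cs.simple_mul_simple_self, one_smul, add_comm]
  · have hcomm : Commute (cs.simple i) (cs.simple s) := hT i hi s hs h
    have hai : cs.simple i • a = a := ha i (Finset.mem_erase.mpr ⟨h, hi⟩)
    rw [smul_add, hai, smul_smul, hcomm.eq, ← smul_smul, hai]

/-- The independent set obtained by deleting `s` from `U`. -/
def Usub {k : ℕ} (U : {T : Finset B // Indep cs T ∧ T.card = k + 1}) (s : {x // x ∈ U.1}) :
    {T : Finset B // Indep cs T ∧ T.card = k} :=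
  ⟨U.1.erase s.1, Indep.mono cs U.2.1 (Finset.erase_subset _ _),
    by simp [Finset.card_erase_of_mem s.2, U.2.2]⟩

/-- The differential of the Coxeter cochain complex: the sum of the maps
`d_{T,s} : v ↦ (-1)^{#{t ∈ T | t < s}} (v + s • v)`. -/
def Xd (o : LinearOrder B) (k : ℕ) : Xc cs R A k →ₗ[R] Xc cs R A (k + 1) where
  toFun x U :=
    ⟨∑ s ∈ U.1.attach,
        csgn o (U.1.erase s.1) s.1 •
          ((x (Usub cs U s) : A) + cs.simple s.1 • (x (Usub cs U s) : A)),
      Submodule.sum_mem _ fun s _ => zsmul_mem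
        (step_mem cs R A U.2.1 s.2 (x (Usub cs U s)).2) _⟩
  map_add' x y := by
    funext U
    apply Subtype.ext
    simp only [Pi.add_apply, Submodule.coe_add]
    rw [← Finset.sum_add_distrib]
    refine Finset.sum_congr rfl fun s _ => ?_
    rw [← smul_add]
    congr 1
    rw [smul_add]
    abel
  map_smul' r x := by
    funext U
    apply Subtype.ext
    simp only [Pi.smul_apply, SetLike.val_smul, RingHom.id_apply]
    rw [Finset.smul_sum]
    refine Finset.sum_congr rfl fun s _ => ?_
    rw [smul_comm (cs.simple s.1) r, ← smul_add, smul_comm]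

/-- Cocycles of the Coxeter cochain complex. -/
def Zc (o : LinearOrder B) (i : ℕ) : Submodule R (Xc cs R A i) := LinearMap.ker (Xd cs R A o i)

/-- Coboundaries of the Coxeter cochain complex. -/
def Bc (o : LinearOrder B) : (i : ℕ) → Submodule R (Xc cs R A i)
  | 0 => ⊥
  | (i + 1) => LinearMap.range (Xd cs R A o i)

/-- The Coxeter cohomology `H^i_C(G, A)` of the Coxeter system `cs` with coefficients in `A`,
with respect to the linear order `o` on the generators. -/
abbrev CoxH (o : LinearOrder B) (i : ℕ) : Type _ :=
  Zc cs R A o i ⧸ (Bc cs R A o i).comap (Zc cs R A o i).subtype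

end CoxeterCochain

section Statement

variable {B : Type*} [DecidableEq B] [Fintype B]
variable {W : Type*} [Group W] {M : CoxeterMatrix B} (cs : CoxeterSystem M W)
variable (A : Type*) [AddCommGroup A] [DistribMulAction W A]

/-- The map `d_{T,s} : v ↦ (-1)^{#{t ∈ T | t < s}} (v + s • v)`, written as a map on all
of `A`. -/
def dTs (o : LinearOrder B) (T : Finset B) (s : B) (a : A) : A :=
  csgn o T s • (a + cs.simple s • a)

lemma csgn_insert_aux (o : LinearOrder B) (T : Finset B) (s s' : B) (hs : s ∉ T) :
    csgn o (insert s T) s' = if s < s' then - csgn o T s' else csgn o T s' := by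
  unfold csgn
  rw [Finset.filter_insert]
  split_ifs with h
  · rw [Finset.card_insert_of_notMem (by simp [hs]), pow_succ]
    simp
  · rfl

lemma dTs_anticomm_aux (o : LinearOrder B) (T : Finset B) (s s' : B) (hs : s ∉ T) (hs' : s' ∉ T)
    (hne : s ≠ s') (hc : Commute (cs.simple s) (cs.simple s')) (a : A) :
    dTs cs A o (insert s T) s' (dTs cs A o T s a) +
      dTs cs A o (insert s' T) s (dTs cs A o T s' a) = 0 := by
  have hz : ∀ (g : W) (n : ℤ) (b : A), g • (n • b) = n • (g • b) := fun g n b => smul_comm g n b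
  have key : csgn o (insert s T) s' * csgn o T s = - (csgn o (insert s' T) s * csgn o T s') := by
    rw [csgn_insert_aux o T s s' hs, csgn_insert_aux o T s' s hs']
    rcases lt_or_gt_of_ne hne with h | h
    · rw [if_pos h, if_neg (not_lt_of_gt h)]; ring
    · rw [if_pos h, if_neg (not_lt_of_gt h)]; ring
  unfold dTs
  rw [hz, hz, ← smul_add, ← smul_add, smul_smul, smul_smul, key]
  have : a + cs.simple s • a + cs.simple s' • (a + cs.simple s • a) =
      a + cs.simple s' • a + cs.simple s • (a + cs.simple s' • a) := by
    rw [smul_add, smul_add, smul_smul, smul_smul, hc.eq]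
    abel
  rw [this, neg_smul, neg_add_cancel]

lemma dTs_sum_aux (o : LinearOrder B) (T : Finset B) (s : B) (F : B → A) (V : Finset B) :
    dTs cs A o T s (∑ t ∈ V, F t) = ∑ t ∈ V, dTs cs A o T s (F t) := by
  unfold dTs
  rw [Finset.smul_sum, ← Finset.sum_add_distrib, Finset.smul_sum]

open Classical in
/-- Extension by zero of a cochain to all finite subsets. -/
noncomputable def extAux {k : ℕ} (x : Xc cs ℤ A k) (T : Finset B) : A :=
  if h : Indep cs T ∧ T.card = k then (x ⟨T, h⟩ : A) else 0

lemma Xd_apply_aux (o : LinearOrder B) (k : ℕ) (x : Xc cs ℤ A k)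
    (U : {T : Finset B // Indep cs T ∧ T.card = k + 1}) :
    ((Xd cs ℤ A o k x) U : A) =
      ∑ s ∈ U.1, dTs cs A o (U.1.erase s) s (extAux cs A x (U.1.erase s)) := by
  rw [← Finset.sum_attach]
  refine Finset.sum_congr rfl fun s _ => ?_
  have : extAux cs A x (U.1.erase s.1) = (x (Usub cs U s) : A) := by
    unfold extAux
    exact dif_pos (Usub cs U s).2
  rw [this]
  rfl

/-- for `T ∈ I(S)` and distinct `s, s' ∈ S ∖ T` with `T ∪ {s, s'} ∈ I(S)`,
`d_{T∪{s},s'} ∘ d_{T,s} + d_{T∪{s'},s} ∘ d_{T,s'} = 0` on `A^{⟨T⟩}`; consequently the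
differential of the Coxeter cochain complex satisfies `d^{k+1} ∘ d^k = 0`. -/
theorem coxeter_differential_squares_to_zero (o : LinearOrder B) :
    (∀ T : Finset B, Indep cs T → ∀ s s' : B, s ∉ T → s' ∉ T → s ≠ s' →
      Indep cs (insert s (insert s' T)) →
      ∀ a ∈ invSub cs ℤ A T,
        dTs cs A o (insert s T) s' (dTs cs A o T s a) +
          dTs cs A o (insert s' T) s (dTs cs A o T s' a) = 0) ∧
    (∀ k : ℕ, (Xd cs ℤ A o (k + 1)).comp (Xd cs ℤ A o k) = 0) := by
  refine ⟨fun T _ s s' hs hs' hne hI a _ =>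
    dTs_anticomm_aux cs A o T s s' hs hs' hne (hI s (by simp) s' (by simp) hne) a, ?_⟩
  intro k
  refine LinearMap.ext fun x => funext fun U => Subtype.ext ?_
  change ((Xd cs ℤ A o (k + 1) (Xd cs ℤ A o k x)) U : A) = 0
  rw [Xd_apply_aux]
  have h1 : ∀ s ∈ U.1, dTs cs A o (U.1.erase s) s
      (extAux cs A (Xd cs ℤ A o k x) (U.1.erase s)) =
      ∑ t ∈ U.1.erase s, dTs cs A o (U.1.erase s) s
        (dTs cs A o ((U.1.erase s).erase t) t (extAux cs A x ((U.1.erase s).erase t))) := by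
    intro s hs
    rw [← dTs_sum_aux]
    congr 1
    have h2 : extAux cs A (Xd cs ℤ A o k x) (U.1.erase s) =
        ((Xd cs ℤ A o k x) (Usub cs U ⟨s, hs⟩) : A) := by
      unfold extAux
      exact dif_pos (Usub cs U ⟨s, hs⟩).2
    rw [h2, Xd_apply_aux]
    rfl
  rw [Finset.sum_congr rfl h1, Finset.sum_sigma']
  refine Finset.sum_involution (fun p _ => ⟨p.2, p.1⟩) ?_ ?_ ?_ ?_
  · rintro ⟨s, t⟩ hp
    simp only [Finset.mem_sigma, Finset.mem_erase] at hp
    obtain ⟨hs, hts, ht⟩ := hp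
    have e1 : U.1.erase s = insert t ((U.1.erase s).erase t) :=
      (Finset.insert_erase (Finset.mem_erase.mpr ⟨hts, ht⟩)).symm
    have e2 : U.1.erase t = insert s ((U.1.erase s).erase t) := by
      rw [Finset.erase_right_comm]
      exact (Finset.insert_erase (Finset.mem_erase.mpr ⟨hts.symm, hs⟩)).symm
    have e3 : (U.1.erase t).erase s = (U.1.erase s).erase t := Finset.erase_right_comm
    have := dTs_anticomm_aux cs A o ((U.1.erase s).erase t) t s (by simp) (by simp) hts
      (U.2.1 t ht s hs hts) (extAux cs A x ((U.1.erase s).erase t))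
    rw [← e1, ← e2] at this
    simp only [e3]
    exact this
  · rintro ⟨s, t⟩ hp _ h
    simp only [Finset.mem_sigma, Finset.mem_erase] at hp
    simp only [Sigma.mk.injEq] at h
    exact hp.2.1 h.1
  · rintro ⟨s, t⟩ hp
    simp only [Finset.mem_sigma, Finset.mem_erase] at hp ⊢
    exact ⟨hp.2.2, hp.2.1.symm, hp.1⟩
  · rintro ⟨s, t⟩ _
    rfl

end Statement
end

section
/- Let (G,S) be a Coxeter system with S finite and let A be a Z[1/2]-module regarded as a Z[G]-module with trivial G-action. Then the map which in each degree k multiplies by 2^{-k} is an isomorphism of cochain complexes from the Coxeter cochain complex X_C^•(G,A) to the complex with the same terms X^k = ⊕_{T ∈ I(S), |T|=k} A and with differential sending the copy of A indexed by T to the copy indexed by T∪{s} via multiplication by (-1)^{|{t ∈ T : t < s}|} (the simplicial differential of the augmented simplicial cochain complex of the independence complex I(S), shifted so that the empty set sits in degree 0). In particular H^i_C(G,A) ≅ H̃^{i-1}(|I(S)|; A), the reduced simplicial cohomology of the geometric realization of I(S), for all i ≥ 0. -/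
set_option linter.unusedSectionVars false

open Finset

section Statement

variable {B : Type*} [DecidableEq B] [Fintype B]
variable {W : Type*} [Group W] {M : CoxeterMatrix B} (cs : CoxeterSystem M W)
variable (A : Type*) [AddCommGroup A]

/-- The degree `k` part of the (shifted, augmented) simplicial cochain complex of the
independence complex `I(S)` with coefficients in the abelian group `A`: one copy of `A` for
each independent subset `T ⊆ S` with `|T| = k` (the empty simplex sits in degree `0`). -/
abbrev Yc (k : ℕ) : Type _ := {T : Finset B // Indep cs T ∧ T.card = k} → A

/-- The simplicial differential: the copy of `A` indexed by `T` is sent to the copy indexed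
by `T ∪ {s}` via multiplication by `(-1)^{#{t ∈ T | t < s}}`. -/
def Yd (o : LinearOrder B) (k : ℕ) : Yc cs A k →ₗ[ℤ] Yc cs A (k + 1) where
  toFun y U := ∑ s ∈ U.1.attach, csgn o (U.1.erase s.1) s.1 • y (Usub cs U s)
  map_add' x y := by
    funext U
    simp [smul_add, Finset.sum_add_distrib]
  map_smul' r x := by
    funext U
    simp only [Pi.smul_apply, RingHom.id_apply]
    rw [Finset.smul_sum]
    exact Finset.sum_congr rfl fun s _ => smul_comm _ _ _

/-- Cocycles of the simplicial cochain complex. -/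
def YZ (o : LinearOrder B) (i : ℕ) : Submodule ℤ (Yc cs A i) := LinearMap.ker (Yd cs A o i)

/-- Coboundaries of the simplicial cochain complex. -/
def YB (o : LinearOrder B) : (i : ℕ) → Submodule ℤ (Yc cs A i)
  | 0 => ⊥
  | (i + 1) => LinearMap.range (Yd cs A o i)

/-- The cohomology of the (shifted, augmented) simplicial cochain complex of `I(S)`; its
degree `i` part is the reduced simplicial cohomology `H̃^{i-1}(|I(S)|; A)`. -/
abbrev YH (o : LinearOrder B) (i : ℕ) : Type _ :=
  YZ cs A o i ⧸ (YB cs A o i).comap (YZ cs A o i).subtype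

/-- if `A` is a `ℤ[1/2]`-module (i.e. doubling is bijective on `A`) regarded as a
`ℤ[G]`-module with trivial `G`-action, then multiplication by `2^{-k}` in each degree `k` is an
isomorphism from the Coxeter cochain complex of `(G,S)` with coefficients in `A` to the
(shifted, augmented) simplicial cochain complex of the independence complex `I(S)` with
coefficients in `A`.  In particular `H^i_C(G,A) ≅ H̃^{i-1}(|I(S)|; A)` for all `i ≥ 0`. -/
theorem coxeter_cochain_complex_of_trivial_action (o : LinearOrder B)
    [DistribMulAction W A]
    (htriv : ∀ (w : W) (a : A), w • a = a)
    (h2 : Function.Bijective (fun a : A => (2 : ℤ) • a)) :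
    ∃ Φ : ∀ k : ℕ, Xc cs ℤ A k ≃ₗ[ℤ] Yc cs A k,
      (∀ (k : ℕ) (x : Xc cs ℤ A k) (T : {T : Finset B // Indep cs T ∧ T.card = k}),
        (2 ^ k : ℤ) • Φ k x T = (x T : A)) ∧
      (∀ (k : ℕ) (x : Xc cs ℤ A k), Yd cs A o k (Φ k x) = Φ (k + 1) (Xd cs ℤ A o k x)) ∧
      (∀ i : ℕ, Nonempty (CoxH cs ℤ A o i ≃ₗ[ℤ] YH cs A o i)) := by
  classical
  let e : A ≃ₗ[ℤ] A := LinearEquiv.ofBijective (LinearMap.lsmul ℤ A 2) h2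
  have he : ∀ a, e a = (2 : ℤ) • a := fun a => rfl
  have hpow : ∀ (k : ℕ) (a : A), (e ^ k) a = (2 ^ k : ℤ) • a := by
    intro k
    induction k with
    | zero => intro a; simp
    | succ k ih =>
      intro a
      rw [pow_succ, LinearEquiv.mul_apply, ih, he, smul_smul, pow_succ]
  have hinj : ∀ (k : ℕ) (a b : A), (2 ^ k : ℤ) • a = (2 ^ k : ℤ) • b → a = b := by
    intro k a b h
    rw [← hpow, ← hpow] at h
    exact (e ^ k).injective h
  have hmem : ∀ (T : Finset B) (a : A), a ∈ invSub cs ℤ A T := fun T a i _ => htriv _ a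
  let inc : ∀ T : Finset B, invSub cs ℤ A T ≃ₗ[ℤ] A := fun T =>
    LinearEquiv.ofBijective (invSub cs ℤ A T).subtype
      ⟨Subtype.val_injective, fun a => ⟨⟨a, hmem T a⟩, rfl⟩⟩
  let Φ : ∀ k : ℕ, Xc cs ℤ A k ≃ₗ[ℤ] Yc cs A k := fun k =>
    LinearEquiv.piCongrRight fun T => (inc T.1).trans (e ^ k).symm
  have h1 : ∀ (k : ℕ) (x : Xc cs ℤ A k) (T : {T : Finset B // Indep cs T ∧ T.card = k}),
        (2 ^ k : ℤ) • Φ k x T = (x T : A) := by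
    intro k x T
    rw [← hpow]
    exact (e ^ k).apply_symm_apply _
  have hd : ∀ (k : ℕ) (x : Xc cs ℤ A k),
      Yd cs A o k (Φ k x) = Φ (k + 1) (Xd cs ℤ A o k x) := by
    intro k x
    funext U
    apply hinj (k + 1)
    rw [h1]
    change (2 ^ (k + 1) : ℤ) • ∑ s ∈ U.1.attach, csgn o (U.1.erase s.1) s.1 • Φ k x (Usub cs U s)
      = ∑ s ∈ U.1.attach, csgn o (U.1.erase s.1) s.1 •
          ((x (Usub cs U s) : A) + cs.simple s.1 • (x (Usub cs U s) : A))
    rw [Finset.smul_sum]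
    refine Finset.sum_congr rfl fun s _ => ?_
    rw [htriv, smul_comm, ← h1 k x (Usub cs U s), ← two_smul ℤ, smul_smul 2, pow_succ']
  refine ⟨Φ, h1, hd, fun i => ?_⟩
  have hZ : (Zc cs ℤ A o i).map (Φ i).toLinearMap = YZ cs A o i := by
    ext y
    constructor
    · rintro ⟨x, hx, rfl⟩
      have hx' : Xd cs ℤ A o i x = 0 := hx
      change Yd cs A o i (Φ i x) = 0
      rw [hd, hx', map_zero]
    · intro hy
      have hy' : Yd cs A o i y = 0 := hy
      refine ⟨(Φ i).symm y, ?_, (Φ i).apply_symm_apply y⟩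
      change Xd cs ℤ A o i ((Φ i).symm y) = 0
      apply (Φ (i + 1)).injective
      rw [← hd, LinearEquiv.apply_symm_apply, hy', map_zero]
  have hB : ∀ x, x ∈ Bc cs ℤ A o i ↔ Φ i x ∈ YB cs A o i := by
    intro x
    cases i with
    | zero =>
      change x = 0 ↔ Φ 0 x = 0
      exact (LinearEquiv.map_eq_zero_iff _).symm
    | succ i =>
      constructor
      · rintro ⟨z, rfl⟩
        exact ⟨Φ i z, hd i z⟩
      · rintro ⟨z, hz⟩
        refine ⟨(Φ i).symm z, (Φ (i + 1)).injective ?_⟩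
        rw [← hd, LinearEquiv.apply_symm_apply, hz]
  let f : Zc cs ℤ A o i ≃ₗ[ℤ] YZ cs A o i := LinearEquiv.ofSubmodules (Φ i) _ _ hZ
  refine ⟨Submodule.Quotient.equiv _ _ f ?_⟩
  ext y
  constructor
  · rintro ⟨x, hx, rfl⟩
    exact (hB x.1).1 hx
  · intro hy
    refine ⟨f.symm y, ?_, f.apply_symm_apply y⟩
    apply (hB _).2
    have : Φ i (f.symm y).1 = y.1 := congrArg Subtype.val (f.apply_symm_apply y)
    rw [Submodule.subtype_apply, this]
    exact hy

end Statement
end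

section
/- Let (G₁,S₁),…,(Gₙ,Sₙ) be Coxeter systems with each Sⱼ finite, let Vⱼ be a representation of Gⱼ over a field K for each j, and let G = G₁ × ⋯ × Gₙ with generating set S = S₁ ∪ ⋯ ∪ Sₙ and V = V₁ ⊠ ⋯ ⊠ Vₙ the external tensor product representation. Then for all i ≥ 0, H^i_C(G,V) ≅ ⊕_{i₁+⋯+iₙ = i} H^{i₁}_C(G₁,V₁) ⊗ ⋯ ⊗ H^{iₙ}_C(Gₙ,Vₙ). -/
set_option linter.unusedSectionVars false

open Finset

open scoped TensorProduct

section
variable {ι : Type*} [Fintype ι] (K : Type*) [Field K]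
variable (Wf : ι → Type*) [∀ j, Group (Wf j)]
variable (Vf : ι → Type*) [∀ j, AddCommGroup (Vf j)] [∀ j, Module K (Vf j)]
  [∀ j, DistribMulAction (Wf j) (Vf j)] [∀ j, SMulCommClass (Wf j) K (Vf j)]

/-- The action of the product group `Π j, W j` on the external tensor product
`V₁ ⊠ ⋯ ⊠ Vₙ = ⨂ⱼ Vⱼ`. -/
noncomputable instance extTensorAction : DistribMulAction (∀ j, Wf j) (⨂[K] j, Vf j) where
  smul w := PiTensorProduct.map fun j => DistribMulAction.toLinearMap K (Vf j) (w j)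
  one_smul x := by
    show PiTensorProduct.map _ x = x
    have h : (fun j => DistribMulAction.toLinearMap K (Vf j) ((1 : ∀ j, Wf j) j)) =
        fun j => (LinearMap.id : Vf j →ₗ[K] Vf j) := by
      funext j
      exact LinearMap.ext fun v => one_smul _ v
    rw [h, PiTensorProduct.map_id]
    rfl
  mul_smul g h x := by
    show PiTensorProduct.map _ x = PiTensorProduct.map _ (PiTensorProduct.map _ x)
    have hc : (fun j => DistribMulAction.toLinearMap K (Vf j) ((g * h) j)) =
        fun j => (DistribMulAction.toLinearMap K (Vf j) (g j)) ∘ₗ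
          (DistribMulAction.toLinearMap K (Vf j) (h j)) := by
      funext j
      exact LinearMap.ext fun v => mul_smul (g j) (h j) v
    rw [hc, PiTensorProduct.map_comp]
    rfl
  smul_zero w := map_zero _
  smul_add w := map_add _

noncomputable instance : SMulCommClass (∀ j, Wf j) K (⨂[K] j, Vf j) where
  smul_comm w c x := by
    show PiTensorProduct.map _ (c • x) = c • PiTensorProduct.map _ x
    exact map_smul _ c x

end

open Finset
open scoped TensorProduct

section AbstractSplit

lemma exists_ginv {K X Y : Type*} [Field K] [AddCommGroup X] [Module K X] [AddCommGroup Y]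
    [Module K Y] (f : X →ₗ[K] Y) : ∃ g : Y →ₗ[K] X, ∀ x, f (g (f x)) = f x := by
  obtain ⟨s, hs⟩ := f.rangeRestrict.exists_rightInverse_of_surjective f.range_rangeRestrict
  obtain ⟨g, hg⟩ := LinearMap.exists_extend s
  refine ⟨g, fun x => ?_⟩
  have h1 : g (f x) = s (f.rangeRestrict x) := by
    rw [← hg]; rfl
  rw [h1]
  have h2 := LinearMap.congr_fun hs (f.rangeRestrict x)
  exact congrArg Subtype.val h2

variable {K : Type*} [Field K] {X : Type*} [AddCommGroup X] [Module K X]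

lemma abstract_split (D : Module.End K X) (p : ℕ → Module.End K X) (N : ℕ)
    (hD : D * D = 0) (hpp : ∀ k l, p k * p l = if k = l then p k else 0)
    (hsum : ∑ k ∈ range N, p k = 1)
    (hpD : ∀ k, p (k + 1) * D = D * p k) (hp0 : p 0 * D = 0)
    (H : ℕ → Type*) [∀ k, AddCommGroup (H k)] [∀ k, Module K (H k)]
    (q : ∀ k, LinearMap.ker D →ₗ[K] H k) (hq : ∀ k, Function.Surjective (q k))
    (hq0 : ∀ k z, q k z = 0 ↔ p k (z : X) ∈ LinearMap.range D)
    (E : Module.End K X)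
    (hpE : ∀ k, p k * E = (-1 : ℤ) ^ k • p k) :
    ∃ (h : Module.End K X) (a : ∀ k, H k →ₗ[K] X) (r : ∀ k, X →ₗ[K] H k),
      D * h + h * D = 1 - ∑ k ∈ range N, a k ∘ₗ r k ∧
      (∀ k, D ∘ₗ a k = 0) ∧ (∀ k, r k ∘ₗ D = 0) ∧ (∀ k, r k ∘ₗ a k = LinearMap.id) ∧
      (∀ k l, k ≠ l → r k ∘ₗ a l = 0) ∧ (∀ k, p k ∘ₗ a k = a k) ∧
      E * h = - (h * E) ∧
      E * (∑ k ∈ range N, a k ∘ₗ r k) = (∑ k ∈ range N, a k ∘ₗ r k) * E := by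
  have hext : ∀ A B : Module.End K X, (∀ k, p k * A = p k * B) → A = B := by
    intro A B hAB
    rw [← one_mul A, ← one_mul B, ← hsum, sum_mul, sum_mul]
    exact sum_congr rfl fun k _ => hAB k
  have hpN : ∀ k, k ∉ range N → p k = 0 := by
    intro k hk
    rw [← mul_one (p k), ← hsum, mul_sum]
    refine sum_eq_zero fun l hl => ?_
    rw [hpp, if_neg]
    rintro rfl; exact hk hl
  have hEcomm : ∀ A : Module.End K X, (∀ k, p k * A = A * p k) → E * A = A * E := by
    intro A hA
    apply hext
    intro k
    rw [← mul_assoc, hpE, smul_mul_assoc, ← mul_assoc, hA, mul_assoc, hpE, mul_smul_comm]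
  obtain ⟨g0, hg0⟩ := exists_ginv D
  have hg0' : D * g0 * D = D := LinearMap.ext hg0
  obtain ⟨g, hg⟩ : ∃ g : Module.End K X, g = ∑ k ∈ range N, p k * g0 * p (k + 1) := ⟨_, rfl⟩
  have hpg' : ∀ k, p k * g = p k * g0 * p (k + 1) := by
    intro k
    rw [hg, mul_sum]
    by_cases hk : k ∈ range N
    · rw [sum_eq_single_of_mem k hk]
      · rw [mul_assoc, ← mul_assoc, hpp, if_pos rfl]
      · intro l _ hl
        rw [mul_assoc, ← mul_assoc, hpp, if_neg (Ne.symm hl), zero_mul]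
    · rw [hpN k hk]; simp
  have hgp' : ∀ k, g * p (k + 1) = p k * g0 * p (k + 1) := by
    intro k
    rw [hg, sum_mul]
    by_cases hk : k ∈ range N
    · rw [sum_eq_single_of_mem k hk]
      · rw [mul_assoc, hpp, if_pos rfl]
      · intro l _ hl
        rw [mul_assoc, hpp, if_neg (by omega), mul_zero]
    · rw [hpN k hk, zero_mul, zero_mul]
      refine sum_eq_zero fun l hl => ?_
      rw [mul_assoc, hpp, if_neg, mul_zero]
      rintro h
      have : l = k := by omega
      exact hk (this ▸ hl)
  have hgp0 : g * p 0 = 0 := by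
    rw [hg, sum_mul]
    refine sum_eq_zero fun l hl => ?_
    rw [mul_assoc, hpp, if_neg (by omega), mul_zero]
  have hpg : ∀ k, p k * g = g * p (k + 1) := fun k => by rw [hpg', hgp']
  have hDgD : D * g * D = D := by
    apply LinearMap.ext
    intro x
    have key : ∀ k, D * g * D * p k = D * p k := by
      intro k
      calc D * g * D * p k = D * (g * p (k+1)) * D := by rw [mul_assoc, ← hpD]; noncomm_ring
        _ = (D * p k) * g0 * (p (k+1) * D) := by rw [hgp']; noncomm_ring
        _ = (p (k+1) * D) * g0 * (D * p k) := by rw [hpD]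
        _ = p (k+1) * (D * g0 * D) * p k := by noncomm_ring
        _ = D * (p k * p k) := by rw [hg0', hpD, mul_assoc]
        _ = D * p k := by rw [hpp, if_pos rfl]
    have : D * g * D * 1 = D * 1 := by
      rw [← hsum, mul_sum, mul_sum]; exact sum_congr rfl fun k _ => key k
    rw [mul_one, mul_one] at this
    rw [this]
  obtain ⟨P, hP⟩ : ∃ P : Module.End K X, P = 1 - D * g - g * D := ⟨_, rfl⟩
  have hDP : D * P = 0 := by
    have : D * P = D - (D * D) * g - D * g * D := by rw [hP]; noncomm_ring
    rw [this, hD, hDgD]; simp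
  have hPD : P * D = 0 := by
    have : P * D = D - D * g * D - g * (D * D) := by rw [hP]; noncomm_ring
    rw [this, hD, hDgD]; simp
  have hpP : ∀ k, p k * P = P * p k := by
    intro k
    have e1 : p k * (g * D) = g * D * p k := by
      rw [← mul_assoc, hpg, mul_assoc, hpD, mul_assoc]
    have e2 : p k * (D * g) = D * g * p k := by
      cases k with
      | zero => rw [← mul_assoc, hp0, mul_assoc, hgp0]; simp
      | succ k => rw [← mul_assoc, hpD, mul_assoc, hpg, mul_assoc]
    rw [hP, mul_sub, mul_sub, sub_mul, sub_mul, e1, e2, mul_one, one_mul]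
  choose s hs using fun k => (q k).exists_rightInverse_of_surjective (LinearMap.range_eq_top.2 (hq k))
  have hs' : ∀ k c, q k (s k c) = c := fun k c => LinearMap.congr_fun (hs k) c
  have hker : ∀ k x, D x = 0 → D (p k x) = 0 := by
    intro k x hx
    have := LinearMap.congr_fun (hpD k) x
    simp only [Module.End.mul_apply] at this
    rw [← this, hx, map_zero]
  have hppx : ∀ k x, p k (p k x) = p k x := by
    intro k x
    have := LinearMap.congr_fun (hpp k k) x
    simpa using this
  have hppx' : ∀ k l x, k ≠ l → p k (p l x) = 0 := by
    intro k l x h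
    have := LinearMap.congr_fun (hpp k l) x
    simpa [h] using this
  have hPker : ∀ x, P x ∈ LinearMap.ker D := fun x => LinearMap.congr_fun hDP x
  have hqp : ∀ k (z : LinearMap.ker D) (w : LinearMap.ker D), p k (z : X) = p k (w : X) →
      q k z = q k w := by
    intro k z w h
    rw [← sub_eq_zero, ← map_sub, hq0]
    have : p k (((z - w : LinearMap.ker D)) : X) = 0 := by
      rw [Submodule.coe_sub, map_sub, h, sub_self]
    rw [this]; exact Submodule.zero_mem _
  let r : ∀ k, X →ₗ[K] H k := fun k => q k ∘ₗ P.codRestrict (LinearMap.ker D) hPker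
  let a : ∀ k, H k →ₗ[K] X := fun k => p k ∘ₗ (LinearMap.ker D).subtype ∘ₗ s k
  have hDa : ∀ k c, D (a k c) = 0 := fun k c => hker k _ (s k c).2
  have hpa : ∀ k c, p k (a k c) = a k c := fun k c => hppx _ _
  have hrz : ∀ k (z : LinearMap.ker D), r k z = q k z := by
    intro k z
    rw [← sub_eq_zero]
    change q k _ - q k z = 0
    rw [← map_sub, hq0]
    have hz : D (z : X) = 0 := z.2
    have h1 : ((P.codRestrict (LinearMap.ker D) hPker (z : X) - z : LinearMap.ker D) : X)
        = D (-(g z)) := by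
      change P (z : X) - z = _
      rw [hP]
      simp [hz]
    rw [h1]
    cases k with
    | zero =>
      have := LinearMap.congr_fun hp0 (-(g z))
      simp only [Module.End.mul_apply] at this
      rw [this]; exact Submodule.zero_mem _
    | succ k =>
      have := LinearMap.congr_fun (hpD k) (-(g z))
      simp only [Module.End.mul_apply] at this
      rw [this]; exact ⟨_, rfl⟩
  have hrD : ∀ k x, r k (D x) = 0 := by
    intro k x
    have : P.codRestrict (LinearMap.ker D) hPker (D x) = 0 :=
      Subtype.ext (LinearMap.congr_fun hPD x)
    change q k _ = 0
    rw [this, map_zero]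
  have hrp : ∀ k x, r k (p k x) = r k x := by
    intro k x
    apply hqp
    have := LinearMap.congr_fun (hpP k) x
    simp only [Module.End.mul_apply] at this
    change p k (P (p k x)) = p k (P x)
    rw [← this, hppx]
  have hrp' : ∀ k l x, k ≠ l → r k (p l x) = 0 := by
    intro k l x h
    rw [← hrp, hppx' _ _ _ h, map_zero]
  have hpr : ∀ k, p k * (∑ k ∈ range N, a k ∘ₗ r k) = (∑ k ∈ range N, a k ∘ₗ r k) * p k := by
    intro k
    rw [mul_sum, sum_mul]
    refine sum_congr rfl fun l _ => LinearMap.ext fun x => ?_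
    simp only [Module.End.mul_apply, LinearMap.comp_apply]
    by_cases h : k = l
    · subst h; rw [hpa, hrp]
    · rw [hrp' _ _ _ (Ne.symm h), ← hpa l, hppx' _ _ _ h, map_zero]
  obtain ⟨Q, hQ⟩ : ∃ Q : Module.End K X, Q = ∑ k ∈ range N, a k ∘ₗ r k := ⟨_, rfl⟩
  have hQD : Q * D = 0 := by
    rw [hQ, sum_mul]
    refine sum_eq_zero fun k _ => LinearMap.ext fun x => ?_
    simp only [Module.End.mul_apply, LinearMap.comp_apply, hrD, map_zero, LinearMap.zero_apply]
  have hrange : ∀ x, (P - Q) x ∈ LinearMap.range D := by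
    intro x
    have : (P - Q) x = ∑ k ∈ range N, (p k (P x) - a k (r k x)) := by
      rw [sum_sub_distrib, LinearMap.sub_apply]
      congr 1
      · have := LinearMap.congr_fun hsum (P x)
        simp only [LinearMap.sum_apply, Module.End.one_apply] at this
        exact this.symm
      · rw [hQ, LinearMap.sum_apply]; rfl
    rw [this]
    refine Submodule.sum_mem _ fun k _ => ?_
    let z : LinearMap.ker D := ⟨P x, hPker x⟩
    have h1 : q k (z - s k (q k z)) = 0 := by rw [map_sub, hs', sub_self]
    rw [hq0, Submodule.coe_sub, map_sub] at h1
    exact h1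
  have hDgPQ : D * g * (P - Q) = P - Q := by
    apply LinearMap.ext
    intro x
    obtain ⟨y, hy⟩ := hrange x
    rw [Module.End.mul_apply, ← hy]
    exact LinearMap.congr_fun hDgD y
  have hEg : E * g = -(g * E) := by
    apply hext
    intro k
    rw [← mul_assoc, hpE, mul_neg, ← mul_assoc, hpg, mul_assoc, hpE, smul_mul_assoc, hpg, pow_succ,
      mul_smul_comm, mul_neg_one, neg_smul, neg_neg]
  refine ⟨g + g * (P - Q), a, r, ?_, fun k => LinearMap.ext (hDa k), fun k => LinearMap.ext (hrD k),
    ?_, ?_, fun k => LinearMap.ext (hpa k), ?_, hEcomm _ hpr⟩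
  · rw [← hQ]
    have : D * (g + g * (P - Q)) + (g + g * (P - Q)) * D
      = D * g + g * D + D * g * (P - Q) + g * (P * D) - g * (Q * D) := by noncomm_ring
    rw [this, hDgPQ, hPD, hQD, hP]
    noncomm_ring
  · intro k
    refine LinearMap.ext fun c => ?_
    change r k (a k c) = c
    have : r k (a k c) = r k (s k c) := hrp _ _
    rw [this, hrz, hs']
  · intro k l hkl
    refine LinearMap.ext fun c => ?_
    exact hrp' _ _ _ hkl
  · have hEP := hEcomm P hpP
    have hEQ := hEcomm Q (by rw [hQ]; exact hpr)
    calc E * (g + g * (P - Q)) = E * g + E * g * P - E * g * Q := by noncomm_ring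
      _ = - (g * E) - g * (E * P) + g * (E * Q) := by rw [hEg]; noncomm_ring
      _ = _ := by rw [hEP, hEQ]; noncomm_ring

end AbstractSplit

section TensorHomotopy
variable {K : Type*} [Field K] {ι : Type*} [Fintype ι] [DecidableEq ι]
variable {X : ι → Type*} [∀ j, AddCommGroup (X j)] [∀ j, Module K (X j)]
variable {Y : ι → Type*} [∀ j, AddCommGroup (Y j)] [∀ j, Module K (Y j)]

lemma ptmap_add (j : ι) (F F1 F2 : ∀ l, X l →ₗ[K] Y l) (h1 : ∀ l, l ≠ j → F1 l = F l)
    (h2 : ∀ l, l ≠ j → F2 l = F l) (h : F1 j + F2 j = F j) :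
    PiTensorProduct.map F1 + PiTensorProduct.map F2 = PiTensorProduct.map F := by
  have e1 : F1 = Function.update F j (F1 j) := by
    funext l
    by_cases hl : l = j
    · subst hl; simp
    · simp [hl, h1 l hl]
  have e2 : F2 = Function.update F j (F2 j) := by
    funext l
    by_cases hl : l = j
    · subst hl; simp
    · simp [hl, h2 l hl]
  have e : F = Function.update F j (F1 j + F2 j) := by rw [h]; simp
  rw [e1, e2]
  rw [← PiTensorProduct.map_update_add, ← e]

lemma ptmap_zero (j : ι) (F : ∀ l, X l →ₗ[K] Y l) (h : F j = 0) :
    PiTensorProduct.map F = 0 :=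
  (PiTensorProduct.mapMultilinear K X Y).map_coord_zero j h

lemma tensor_homotopy {n : ℕ} (e : ι ≃ Fin n) (d h p E : ∀ j, Module.End K (X j))
    (hdh : ∀ j, d j * h j + h j * d j = 1 - p j) (hdp : ∀ j, d j * p j = 0)
    (hpd : ∀ j, p j * d j = 0) (hEh : ∀ j, E j * h j = - (h j * E j))
    (hEp : ∀ j, E j * p j = p j * E j) (hEE : ∀ j, E j * E j = 1) :
    ∃ h' : Module.End K (⨂[K] j, X j),
      (∑ j, PiTensorProduct.map (fun l => if e l < e j then E l else if l = j then d l else 1)) * h' +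
      h' * (∑ j, PiTensorProduct.map (fun l => if e l < e j then E l else if l = j then d l else 1))
       = 1 - PiTensorProduct.map p := by
  let Df : ι → ∀ l, Module.End K (X l) := fun j l =>
    if e l < e j then E l else if l = j then d l else 1
  let Hf : ι → ∀ l, Module.End K (X l) := fun j l =>
    if e l < e j then p l * E l else if l = j then h l else 1
  let Tf : ι → ∀ l, Module.End K (X l) := fun j l =>
    if e l < e j then p l else if l = j then 1 - p l else 1
  let Q : ℕ → Module.End K (⨂[K] j, X j) := fun m =>
    PiTensorProduct.map (fun l => if (e l : ℕ) < m then p l else 1)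
  have key : ∀ i j, PiTensorProduct.map (Df i) * PiTensorProduct.map (Hf j) +
      PiTensorProduct.map (Hf j) * PiTensorProduct.map (Df i) =
      if i = j then PiTensorProduct.map (Tf j) else 0 := by
    intro i j
    rw [← PiTensorProduct.map_mul, ← PiTensorProduct.map_mul]
    rcases lt_trichotomy (e i) (e j) with hij | hij | hij
    · have hne : i ≠ j := by rintro rfl; exact lt_irrefl _ hij
      rw [if_neg hne, ptmap_zero i, ptmap_zero i, add_zero]
      · simp only [Df, Hf, if_pos hij, lt_irrefl, if_false, if_true]
        rw [← hEp, mul_assoc, hpd, mul_zero]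
      · simp only [Df, Hf, if_pos hij, lt_irrefl, if_false, if_true]
        rw [← mul_assoc, hdp, zero_mul]
    · have hne : i = j := e.injective hij
      subst hne
      rw [if_pos rfl]
      apply ptmap_add i
      · intro l hl
        simp only [Df, Hf, Tf, if_neg hl]
        split_ifs
        · rw [← mul_assoc, hEp, mul_assoc, hEE, mul_one]
        · simp
      · intro l hl
        simp only [Df, Hf, Tf, if_neg hl]
        split_ifs
        · rw [mul_assoc, hEE, mul_one]
        · simp
      · simp only [Df, Hf, Tf, lt_irrefl, if_false, if_true]
        exact hdh i
    · have hne : i ≠ j := by rintro rfl; exact lt_irrefl _ hij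
      rw [if_neg hne]
      rw [ptmap_add j (Function.update (fun l => Hf j l * Df i l) j 0)]
      · exact ptmap_zero j _ (by simp)
      · intro l hl
        simp only [Function.update_of_ne hl, Df, Hf, if_neg hl]
        split_ifs with h1 h2
        · rw [← mul_assoc, hEp]
        all_goals first | (exfalso; subst_vars; order) | simp_all
      · intro l hl
        simp only [Function.update_of_ne hl]
      · simp only [Function.update_self, Df, Hf, lt_irrefl, if_false, if_true, if_pos hij]
        rw [hEh, neg_add_cancel]
  have tel : ∀ j, PiTensorProduct.map (Tf j) = Q (e j) - Q ((e j : ℕ) + 1) := by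
    intro j
    rw [eq_sub_iff_add_eq]
    apply ptmap_add j
    · intro l hl
      simp only [Tf, if_neg hl, Fin.lt_def]
    · intro l hl
      have : (e l : ℕ) ≠ e j := fun h => hl (e.injective (Fin.ext h))
      have h2 : (e l : ℕ) < e j + 1 ↔ (e l : ℕ) < e j := by omega
      simp only [h2]
    · simp [Tf]
  refine ⟨∑ j, PiTensorProduct.map (Hf j), ?_⟩
  change (∑ i, PiTensorProduct.map (Df i)) * _ + _ * (∑ i, PiTensorProduct.map (Df i)) = _
  rw [sum_mul_sum, sum_mul_sum, sum_comm (f := fun i j => PiTensorProduct.map (Hf i) * PiTensorProduct.map (Df j)),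
    ← sum_add_distrib]
  simp_rw [← sum_add_distrib, key]
  simp only [sum_ite_eq, mem_univ, if_true, tel]
  rw [e.sum_comp (fun m : Fin n => Q m - Q ((m : ℕ) + 1)),
    Fin.sum_univ_eq_sum_range (fun m => Q m - Q (m + 1)), sum_range_sub']
  congr 1
  · simp only [Q, not_lt_zero, if_false]
    exact PiTensorProduct.map_one
  · simp only [Q, Fin.is_lt, if_true]

end TensorHomotopy

open Finset
open scoped TensorProduct

section AbstractKunneth
open scoped DirectSum

lemma abstract_kunneth {K : Type*} [Field K] {ι : Type*} [Fintype ι] [DecidableEq ι]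
    {n : ℕ} (e : ι ≃ Fin n)
    {X : ι → Type*} [∀ j, AddCommGroup (X j)] [∀ j, Module K (X j)]
    (D : ∀ j, Module.End K (X j)) (p : ∀ j, ℕ → Module.End K (X j)) (N : ι → ℕ)
    (hD : ∀ j, D j * D j = 0) (hpp : ∀ j k l, p j k * p j l = if k = l then p j k else 0)
    (hsum : ∀ j, ∑ k ∈ range (N j), p j k = 1)
    (hpD : ∀ j k, p j (k + 1) * D j = D j * p j k) (hp0 : ∀ j, p j 0 * D j = 0)
    (H : ι → ℕ → Type*) [∀ j k, AddCommGroup (H j k)] [∀ j k, Module K (H j k)]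
    (q : ∀ j k, LinearMap.ker (D j) →ₗ[K] H j k) (hq : ∀ j k, Function.Surjective (q j k))
    (hq0 : ∀ j k z, q j k z = 0 ↔ p j k (z : X j) ∈ LinearMap.range (D j))
    (E : ∀ j, Module.End K (X j)) (hpE : ∀ j k, p j k * E j = (-1 : ℤ) ^ k • p j k)
    (hEE : ∀ j, E j * E j = 1)
    {X' : Type*} [AddCommGroup X'] [Module K X'] (D' p' : Module.End K X')
    (hp'D : ∀ y, p' (D' y) ∈ LinearMap.range D')
    {H' : Type*} [AddCommGroup H'] [Module K H'] (q' : LinearMap.ker D' →ₗ[K] H')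
    (hq' : Function.Surjective q')
    (hq'0 : ∀ z, q' z = 0 ↔ p' (z : X') ∈ LinearMap.range D')
    (m : (⨂[K] j, X j) ≃ₗ[K] X')
    (hm : ∀ t, D' (m t) = m ((∑ j, PiTensorProduct.map
      (fun l => if e l < e j then E l else if l = j then D l else 1)) t))
    (i : ℕ)
    (hdeg : ∀ (f : ι → ℕ) t, p' (m (PiTensorProduct.map (fun j => p j (f j)) t)) =
      if ∑ j, f j = i then m (PiTensorProduct.map (fun j => p j (f j)) t) else 0) :
    Nonempty (H' ≃ₗ[K] ⨁ (f : {f : ι → ℕ // ∑ j, f j = i}), ⨂[K] j, H j (f.1 j)) := by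
  choose h a r hdh hDa hrD hra hra' hpa hEh hEp using fun j =>
    abstract_split (D j) (p j) (N j) (hD j) (hpp j) (hsum j) (hpD j) (hp0 j) (H j) (q j)
      (hq j) (hq0 j) (E j) (hpE j)
  obtain ⟨h', hh'⟩ := tensor_homotopy e D h (fun j => ∑ k ∈ range (N j), a j k ∘ₗ r j k) E hdh
    (fun j => by
      rw [mul_sum]
      refine sum_eq_zero fun k _ => ?_
      rw [Module.End.mul_eq_comp, ← LinearMap.comp_assoc, hDa, LinearMap.zero_comp])
    (fun j => by
      rw [sum_mul]
      refine sum_eq_zero fun k _ => ?_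
      rw [Module.End.mul_eq_comp, LinearMap.comp_assoc, hrD, LinearMap.comp_zero])
    hEh hEp hEE
  obtain ⟨DT, hDT⟩ : ∃ DT : Module.End K (⨂[K] j, X j), DT = (∑ j, PiTensorProduct.map
      (fun l => if e l < e j then E l else if l = j then D l else 1)) := ⟨_, rfl⟩
  rw [← hDT] at hh'
  rw [← hDT] at hm
  have hDTa : ∀ (f : ι → ℕ) u, DT (PiTensorProduct.map (fun j => a j (f j)) u) = 0 := by
    intro f u
    rw [hDT, LinearMap.sum_apply]
    refine sum_eq_zero fun j _ => ?_
    rw [← LinearMap.comp_apply, ← PiTensorProduct.map_comp, ptmap_zero j, LinearMap.zero_apply]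
    simp only [lt_irrefl, if_false, if_true, hDa]
  have hrDT : ∀ (f : ι → ℕ) t, PiTensorProduct.map (fun j => r j (f j)) (DT t) = 0 := by
    intro f t
    rw [hDT, LinearMap.sum_apply, map_sum]
    refine sum_eq_zero fun j _ => ?_
    rw [← LinearMap.comp_apply, ← PiTensorProduct.map_comp, ptmap_zero j, LinearMap.zero_apply]
    simp only [lt_irrefl, if_false, if_true, hrD]
  let A : ∀ f : ι → ℕ, (⨂[K] j, H j (f j)) →ₗ[K] X' := fun f =>
    m.toLinearMap ∘ₗ PiTensorProduct.map (fun j => a j (f j))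
  have hA : ∀ f u, A f u ∈ LinearMap.ker D' := by
    intro f u
    rw [LinearMap.mem_ker]
    change D' (m _) = 0
    rw [hm, hDTa, map_zero]
  have hpA : ∀ f u, p' (A f u) = if ∑ j, f j = i then A f u else 0 := by
    intro f u
    have : A f u = m (PiTensorProduct.map (fun j => p j (f j))
        (PiTensorProduct.map (fun j => a j (f j)) u)) := by
      rw [← LinearMap.comp_apply, ← PiTensorProduct.map_comp]
      simp only [hpa]
      rfl
    rw [this, hdeg]
  let Ak : ∀ f : ι → ℕ, (⨂[K] j, H j (f j)) →ₗ[K] LinearMap.ker D' := fun f =>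
    (A f).codRestrict _ (hA f)
  let Psi : (⨁ (f : {f : ι → ℕ // ∑ j, f j = i}), ⨂[K] j, H j (f.1 j)) →ₗ[K] LinearMap.ker D' :=
    DirectSum.toModule K _ _ (fun f => Ak f.1)
  have hpPsi : ∀ u, p' (Psi u : X') = Psi u := by
    have : p' ∘ₗ (LinearMap.ker D').subtype ∘ₗ Psi = (LinearMap.ker D').subtype ∘ₗ Psi := by
      apply DirectSum.linearMap_ext
      intro f
      apply LinearMap.ext
      intro u
      simp only [LinearMap.comp_apply, Psi, DirectSum.toModule_lof]
      change p' (A f.1 u) = A f.1 u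
      rw [hpA, if_pos f.2]
    exact fun u => LinearMap.congr_fun this u
  have hrPsi : ∀ f : {f : ι → ℕ // ∑ j, f j = i}, ∀ u,
      PiTensorProduct.map (fun j => r j (f.1 j)) (m.symm (Psi u : X')) = u f := by
    intro f
    have : PiTensorProduct.map (fun j => r j (f.1 j)) ∘ₗ m.symm.toLinearMap ∘ₗ
        (LinearMap.ker D').subtype ∘ₗ Psi = DirectSum.component K _ _ f := by
      apply DirectSum.linearMap_ext
      intro f'
      apply LinearMap.ext
      intro u
      simp only [LinearMap.comp_apply, Psi, DirectSum.toModule_lof]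
      change PiTensorProduct.map (fun j => r j (f.1 j)) (m.symm (m _)) = _
      rw [LinearEquiv.symm_apply_apply, ← LinearMap.comp_apply, ← PiTensorProduct.map_comp]
      by_cases hf : f' = f
      · subst hf
        simp only [hra, PiTensorProduct.map_id]
        rw [DirectSum.component.lof_self]
        rfl
      · have : ∃ j, f.1 j ≠ f'.1 j := by
          by_contra hcon
          push Not at hcon
          exact hf (Subtype.ext (funext fun j => (hcon j).symm))
        obtain ⟨j, hj⟩ := this
        rw [ptmap_zero j _ (hra' j _ _ hj), DirectSum.component.of, dif_neg hf]
        rfl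
    exact fun u => LinearMap.congr_fun this u
  let Theta := q' ∘ₗ Psi
  refine ⟨(LinearEquiv.ofBijective Theta ⟨?_, ?_⟩).symm⟩
  · rw [← LinearMap.ker_eq_bot, LinearMap.ker_eq_bot']
    intro u hu
    change q' (Psi u) = 0 at hu
    rw [hq'0, hpPsi] at hu
    obtain ⟨y, hy⟩ := hu
    refine DFinsupp.ext fun f => ?_
    rw [← hrPsi, ← hy]
    obtain ⟨t, rfl⟩ := m.surjective y
    rw [hm, LinearEquiv.symm_apply_apply, hrDT]
    rfl
  · intro c
    obtain ⟨z, rfl⟩ := hq' c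
    rw [← LinearMap.mem_range]
    obtain ⟨t, ht⟩ := m.surjective (z : X')
    have hDt : DT t = 0 := by
      apply m.injective
      rw [← hm, ht, map_zero]
      exact z.2
    have h1 := LinearMap.congr_fun hh' t
    simp only [LinearMap.add_apply, Module.End.mul_apply, hDt, map_zero, add_zero,
      LinearMap.sub_apply, Module.End.one_apply] at h1
    have h2 : PiTensorProduct.map (fun j => ∑ k ∈ range (N j), a j k ∘ₗ r j k) =
        ∑ f ∈ Fintype.piFinset (fun j => range (N j)),
          PiTensorProduct.map (fun j => a j (f j) ∘ₗ r j (f j)) :=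
      (PiTensorProduct.mapMultilinear K X X).map_sum_finset (fun j k => a j k ∘ₗ r j k)
        (fun j => range (N j))
    rw [h2, LinearMap.sum_apply] at h1
    have h3 : ∀ f : ι → ℕ, m (PiTensorProduct.map (fun j => a j (f j) ∘ₗ r j (f j)) t) =
        A f (PiTensorProduct.map (fun j => r j (f j)) t) := by
      intro f
      rw [PiTensorProduct.map_comp]
      rfl
    have h4 : (z : X') - ∑ f ∈ Fintype.piFinset (fun j => range (N j)),
        A f (PiTensorProduct.map (fun j => r j (f j)) t) = D' (m (h' t)) := by
      rw [hm, h1, map_sub, map_sum, ht]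
      simp only [h3]
    have h5 : q' (z - ∑ f ∈ Fintype.piFinset (fun j => range (N j)),
        Ak f (PiTensorProduct.map (fun j => r j (f j)) t)) = 0 := by
      rw [hq'0]
      have : ((z - ∑ f ∈ Fintype.piFinset (fun j => range (N j)),
        Ak f (PiTensorProduct.map (fun j => r j (f j)) t) : LinearMap.ker D') : X') =
          D' (m (h' t)) := by
        rw [← h4]
        simp [Ak]
      rw [this]
      exact hp'D _
    rw [map_sub, sub_eq_zero] at h5
    rw [h5, map_sum]
    refine Submodule.sum_mem _ fun f _ => ?_
    by_cases hf : ∑ j, f j = i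
    · refine ⟨DirectSum.lof K _ (fun f : {f : ι → ℕ // ∑ j, f j = i} => ⨂[K] j, H j (f.1 j))
        ⟨f, hf⟩ (PiTensorProduct.map (fun j => r j (f j)) t), ?_⟩
      simp only [Theta, Psi, LinearMap.comp_apply, DirectSum.toModule_lof]
    · have : q' (Ak f (PiTensorProduct.map (fun j => r j (f j)) t)) = 0 := by
        rw [hq'0]
        change p' (A f _) ∈ _
        rw [hpA, if_neg hf]
        exact Submodule.zero_mem _
      rw [this]
      exact Submodule.zero_mem _

end AbstractKunneth

open Finset
open scoped TensorProduct

section TotalComplex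

variable {B : Type*} [DecidableEq B] [Fintype B]
variable {W : Type*} [Group W] {M : CoxeterMatrix B} (cs : CoxeterSystem M W)

lemma csgn_erase (o : LinearOrder B) (T : Finset B) (s t : B) (ht : t ∈ T) :
    csgn o T s = (if o.lt t s then -1 else 1) * csgn o (T.erase t) s := by
  let _ := o
  change (-1) ^ (T.filter (fun t => t < s)).card = (if t < s then -1 else 1) *
    (-1) ^ ((T.erase t).filter (fun t => t < s)).card
  rw [filter_erase]
  split_ifs with h
  · have hmem : t ∈ T.filter (fun t => t < s) := by simp [ht, h]
    rw [← card_erase_add_one hmem, pow_succ]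
    ring
  · rw [erase_eq_of_notMem (by simp [h]), one_mul]

lemma csgn_swap (o : LinearOrder B) (U : Finset B) (s t : B) (hs : s ∈ U) (ht : t ∈ U)
    (hst : s ≠ t) :
    csgn o (U.erase s) s * csgn o ((U.erase s).erase t) t =
      -(csgn o (U.erase t) t * csgn o ((U.erase t).erase s) s) := by
  rw [csgn_erase o (U.erase s) s t (by simp [ht, hst.symm]),
    csgn_erase o (U.erase t) t s (by simp [hs, hst]), erase_right_comm (a := t)]
  let _ := o
  change (if t < s then -1 else 1) * _ * _ = -((if s < t then -1 else 1) * _ * _)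
  rcases lt_or_gt_of_ne hst with h | h
  · rw [if_neg (lt_asymm h), if_pos h]; ring
  · rw [if_pos h, if_neg (lt_asymm h)]; ring

variable (R : Type*) [CommRing R] (A : Type*) [AddCommGroup A] [Module R A]
  [DistribMulAction W A] [SMulCommClass W R A]

/-- The `T`-component of the total complex, as a submodule of `A`. -/
def Fsub (T : Finset B) : Submodule R A where
  carrier := {a | a ∈ invSub cs R A T ∧ (¬ Indep cs T → a = 0)}
  add_mem' ha hb := ⟨add_mem ha.1 hb.1, fun h => by rw [ha.2 h, hb.2 h, add_zero]⟩
  zero_mem' := ⟨zero_mem _, fun _ => rfl⟩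
  smul_mem' r a ha := ⟨Submodule.smul_mem _ r ha.1, fun h => by rw [ha.2 h, smul_zero]⟩

/-- The total Coxeter complex. -/
def Xt : Submodule R (Finset B → A) where
  carrier := {x | ∀ T, x T ∈ Fsub cs R A T}
  add_mem' ha hb := fun T => add_mem (ha T) (hb T)
  zero_mem' := fun _ => zero_mem _
  smul_mem' r a ha := fun T => Submodule.smul_mem _ r (ha T)

/-- Diagonal operators on the total complex. -/
def diagt (c : Finset B → ℤ) : Module.End R (Xt cs R A) where
  toFun x := ⟨fun T => c T • x.1 T, fun T => zsmul_mem (x.2 T) _⟩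
  map_add' x y := Subtype.ext (funext fun T => smul_add _ _ _)
  map_smul' r x := Subtype.ext (funext fun T => smul_comm _ _ _)

/-- Projection to degree `k`. -/
def pt (k : ℕ) : Module.End R (Xt cs R A) := diagt cs R A (fun T => if T.card = k then 1 else 0)

/-- The sign operator. -/
def Et : Module.End R (Xt cs R A) := diagt cs R A (fun T => (-1) ^ T.card)

open Classical in
/-- The total differential. -/
noncomputable def Dt (o : LinearOrder B) : Module.End R (Xt cs R A) where
  toFun x := ⟨fun U => if Indep cs U then ∑ s ∈ U, csgn o (U.erase s) s •
      (x.1 (U.erase s) + cs.simple s • x.1 (U.erase s)) else 0, fun U => by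
    dsimp only
    split_ifs with h
    · refine ⟨Submodule.sum_mem _ fun s hs => zsmul_mem ?_ _, fun h' => absurd h h'⟩
      exact step_mem cs R A h hs (x.2 _).1
    · exact zero_mem _⟩
  map_add' x y := by
    refine Subtype.ext (funext fun U => ?_)
    simp only [Submodule.coe_add, Pi.add_apply]
    split_ifs
    · rw [← sum_add_distrib]
      refine sum_congr rfl fun s _ => ?_
      rw [← smul_add, smul_add (cs.simple s)]
      congr 1
      abel
    · simp
  map_smul' r x := by
    refine Subtype.ext (funext fun U => ?_)
    simp only [Submodule.coe_smul, Pi.smul_apply, RingHom.id_apply]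
    split_ifs
    · rw [smul_sum]
      refine sum_congr rfl fun s _ => ?_
      rw [smul_comm (cs.simple s) r, ← smul_add, smul_comm]
    · simp

variable {R A}

lemma Xt_ext {x y : Xt cs R A} (h : ∀ T, x.1 T = y.1 T) : x = y := Subtype.ext (funext h)

lemma diagt_apply (c : Finset B → ℤ) (x : Xt cs R A) (T : Finset B) :
    (diagt cs R A c x).1 T = c T • x.1 T := rfl

lemma pt_apply (k : ℕ) (x : Xt cs R A) (T : Finset B) :
    (pt cs R A k x).1 T = if T.card = k then x.1 T else 0 := by
  rw [pt, diagt_apply]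
  split_ifs <;> simp

lemma Dt_apply (o : LinearOrder B) (x : Xt cs R A) (U : Finset B) (hU : Indep cs U) :
    (Dt cs R A o x).1 U = ∑ s ∈ U, csgn o (U.erase s) s •
      (x.1 (U.erase s) + cs.simple s • x.1 (U.erase s)) := by
  exact if_pos hU

lemma Xt_not {x : Xt cs R A} {U : Finset B} (hU : ¬ Indep cs U) : x.1 U = 0 := (x.2 U).2 hU

variable (R A)

lemma pt_mul (k l : ℕ) : pt cs R A k * pt cs R A l = if k = l then pt cs R A k else 0 := by
  refine LinearMap.ext fun x => Xt_ext cs fun T => ?_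
  rw [Module.End.mul_apply, pt_apply, pt_apply]
  by_cases h : k = l
  · subst h
    rw [if_pos rfl, pt_apply]
    split_ifs <;> rfl
  · rw [if_neg h]
    change _ = (0 : A)
    split_ifs <;> first | rfl | omega

lemma pt_sum : ∑ k ∈ range (Fintype.card B + 1), pt cs R A k = 1 := by
  refine LinearMap.ext fun x => Xt_ext cs fun T => ?_
  rw [LinearMap.sum_apply, Submodule.coe_sum, Finset.sum_apply]
  simp only [pt_apply]
  rw [sum_ite_eq, if_pos]
  · rfl
  · rw [mem_range]
    have := card_le_univ T
    omega

lemma pt_E (k : ℕ) : pt cs R A k * Et cs R A = (-1 : ℤ) ^ k • pt cs R A k := by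
  refine LinearMap.ext fun x => Xt_ext cs fun T => ?_
  rw [Module.End.mul_apply, pt_apply]
  change _ = (-1 : ℤ) ^ k • (pt cs R A k x).1 T
  rw [pt_apply]
  split_ifs with h
  · rw [← h]; rfl
  · simp

lemma Et_E : Et cs R A * Et cs R A = 1 := by
  refine LinearMap.ext fun x => Xt_ext cs fun T => ?_
  rw [Module.End.mul_apply, Et, diagt_apply, diagt_apply, smul_smul, ← mul_pow]
  simp

lemma pt_D (o : LinearOrder B) (k : ℕ) :
    pt cs R A (k + 1) * Dt cs R A o = Dt cs R A o * pt cs R A k := by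
  refine LinearMap.ext fun x => Xt_ext cs fun T => ?_
  rw [Module.End.mul_apply, Module.End.mul_apply]
  by_cases hT : Indep cs T
  · rw [pt_apply, Dt_apply _ _ _ _ hT, Dt_apply _ _ _ _ hT]
    split_ifs with h
    · refine sum_congr rfl fun s hs => ?_
      rw [pt_apply, if_pos]
      rw [card_erase_of_mem hs]; omega
    · symm
      refine sum_eq_zero fun s hs => ?_
      rw [pt_apply, if_neg, smul_zero, add_zero, smul_zero]
      have := card_erase_add_one hs
      omega
  · rw [Xt_not cs hT, Xt_not cs hT]

lemma pt_D0 (o : LinearOrder B) : pt cs R A 0 * Dt cs R A o = 0 := by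
  refine LinearMap.ext fun x => Xt_ext cs fun T => ?_
  rw [Module.End.mul_apply, pt_apply]
  change _ = (0 : A)
  split_ifs with h
  · by_cases hT : Indep cs T
    · rw [Dt_apply _ _ _ _ hT, card_eq_zero.1 h, sum_empty]
    · exact Xt_not cs hT
  · rfl

lemma Dt_D (o : LinearOrder B) : Dt cs R A o * Dt cs R A o = 0 := by
  refine LinearMap.ext fun x => Xt_ext cs fun U => ?_
  rw [Module.End.mul_apply]
  change _ = (0 : A)
  by_cases hU : Indep cs U
  swap
  · exact Xt_not cs hU
  rw [Dt_apply _ _ _ _ hU]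
  let G : (Σ _ : B, B) → A := fun st =>
    (csgn o (U.erase st.1) st.1 * csgn o ((U.erase st.1).erase st.2) st.2) •
      ((x.1 ((U.erase st.1).erase st.2) + cs.simple st.2 • x.1 ((U.erase st.1).erase st.2)) +
        cs.simple st.1 • (x.1 ((U.erase st.1).erase st.2) +
          cs.simple st.2 • x.1 ((U.erase st.1).erase st.2)))
  have h1 : ∀ s ∈ U, csgn o (U.erase s) s • ((Dt cs R A o x).1 (U.erase s) +
      cs.simple s • (Dt cs R A o x).1 (U.erase s)) = ∑ t ∈ U.erase s, G ⟨s, t⟩ := by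
    intro s hs
    rw [Dt_apply _ _ _ _ (hU.mono cs (erase_subset _ _)), smul_sum, ← sum_add_distrib, smul_sum]
    refine sum_congr rfl fun t ht => ?_
    rw [smul_comm (cs.simple s), ← smul_add, smul_smul]
  rw [sum_congr rfl h1, sum_sigma']
  have hG : ∀ s ∈ U, ∀ t ∈ U, s ≠ t → G ⟨s, t⟩ + G ⟨t, s⟩ = 0 := by
    intro s hs t ht hst
    simp only [G]
    rw [csgn_swap o U s t hs ht hst, erase_right_comm (a := s), neg_smul, neg_add_eq_zero]
    congr 1
    simp only [smul_add, smul_smul]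
    rw [(hU s hs t ht hst).eq]
    abel
  refine sum_involution (fun st _ => ⟨st.2, st.1⟩) ?_ ?_ ?_ ?_
  · rintro ⟨s, t⟩ h
    simp only [mem_sigma, mem_erase] at h
    exact hG s h.1 t h.2.2 (Ne.symm h.2.1)
  · rintro ⟨s, t⟩ h _ heq
    simp only [mem_sigma, mem_erase] at h
    exact h.2.1 (congrArg Sigma.fst heq)
  · rintro ⟨s, t⟩ h
    simp only [mem_sigma, mem_erase] at h ⊢
    exact ⟨h.2.2, Ne.symm h.2.1, h.1⟩
  · rintro ⟨s, t⟩ h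
    rfl

/-- Restriction to degree `k`. -/
def rest (k : ℕ) : Xt cs R A →ₗ[R] Xc cs R A k where
  toFun x T := ⟨x.1 T.1, (x.2 T.1).1⟩
  map_add' x y := rfl
  map_smul' r x := rfl

open Classical in
/-- Extension by zero from degree `k`. -/
noncomputable def extt (k : ℕ) (y : Xc cs R A k) : Xt cs R A :=
  ⟨fun T => if h : Indep cs T ∧ T.card = k then (y ⟨T, h⟩ : A) else 0, fun T => by
    dsimp only
    split_ifs with h
    · exact ⟨(y ⟨T, h⟩).2, fun h' => absurd h.1 h'⟩
    · exact zero_mem _⟩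

lemma rest_extt (k : ℕ) (y : Xc cs R A k) : rest cs R A k (extt cs R A k y) = y := by
  funext T
  apply Subtype.ext
  exact dif_pos T.2

lemma extt_rest (k : ℕ) (x : Xt cs R A) : extt cs R A k (rest cs R A k x) = pt cs R A k x := by
  refine Xt_ext cs fun T => ?_
  rw [pt_apply]
  by_cases h : Indep cs T
  · by_cases h2 : T.card = k
    · rw [if_pos h2]; exact dif_pos ⟨h, h2⟩
    · rw [if_neg h2]; exact dif_neg (fun h3 => h2 h3.2)
  · rw [Xt_not cs h, Xt_not cs h, ite_self]

lemma extt_zero (k : ℕ) : extt cs R A k 0 = 0 := by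
  refine Xt_ext cs fun T => ?_
  by_cases h : Indep cs T ∧ T.card = k
  · exact dif_pos h
  · exact dif_neg h

lemma rest_pt (k : ℕ) (x : Xt cs R A) : rest cs R A k (pt cs R A k x) = rest cs R A k x := by
  rw [← extt_rest, rest_extt]

lemma rest_D (o : LinearOrder B) (k : ℕ) (x : Xt cs R A) :
    rest cs R A (k + 1) (Dt cs R A o x) = Xd cs R A o k (rest cs R A k x) := by
  funext U
  apply Subtype.ext
  change (Dt cs R A o x).1 U.1 = ∑ s ∈ U.1.attach, csgn o (U.1.erase s.1) s.1 •
          (x.1 (U.1.erase s.1) + cs.simple s.1 • x.1 (U.1.erase s.1))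
  rw [Dt_apply _ _ _ _ U.2.1, sum_attach U.1 (fun s => csgn o (U.1.erase s) s •
          (x.1 (U.1.erase s) + cs.simple s • x.1 (U.1.erase s)))]

lemma D_extt (o : LinearOrder B) (k : ℕ) (y : Xc cs R A k) :
    Dt cs R A o (extt cs R A k y) = extt cs R A (k + 1) (Xd cs R A o k y) := by
  have h1 := LinearMap.congr_fun (pt_D cs R A o k) (extt cs R A k y)
  simp only [Module.End.mul_apply] at h1
  rw [← extt_rest cs R A k, rest_extt, ← extt_rest, rest_D, rest_extt] at h1
  exact h1.symm

/-- The map from total cocycles to cohomology. -/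
noncomputable def qt (o : LinearOrder B) (k : ℕ) :
    LinearMap.ker (Dt cs R A o) →ₗ[R] CoxH cs R A o k :=
  ((Bc cs R A o k).comap (Zc cs R A o k).subtype).mkQ ∘ₗ
    ((rest cs R A k) ∘ₗ (LinearMap.ker (Dt cs R A o)).subtype).codRestrict (Zc cs R A o k)
      (fun z => by
        change Xd cs R A o k (rest cs R A k z) = 0
        rw [← rest_D, z.2, map_zero])

lemma qt_surj (o : LinearOrder B) (k : ℕ) : Function.Surjective (qt cs R A o k) := by
  intro c
  obtain ⟨z, rfl⟩ := Submodule.mkQ_surjective _ c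
  have hz : Xd cs R A o k z.1 = 0 := z.2
  refine ⟨⟨extt cs R A k z.1, ?_⟩, ?_⟩
  · rw [LinearMap.mem_ker, D_extt, hz, extt_zero]
  · change Submodule.mkQ _ _ = Submodule.mkQ _ _
    congr 1
    exact Subtype.ext (rest_extt cs R A k z.1)

lemma qt_zero (o : LinearOrder B) (k : ℕ) (z : LinearMap.ker (Dt cs R A o)) :
    qt cs R A o k z = 0 ↔ pt cs R A k (z : Xt cs R A) ∈ LinearMap.range (Dt cs R A o) := by
  have h1 : qt cs R A o k z = 0 ↔ rest cs R A k z ∈ Bc cs R A o k := by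
    change Submodule.Quotient.mk _ = 0 ↔ _
    rw [Submodule.Quotient.mk_eq_zero]
    rfl
  rw [h1]
  cases k with
  | zero =>
    constructor
    · intro h
      have h : rest cs R A 0 z = 0 := h
      rw [← extt_rest, h, extt_zero]
      exact zero_mem _
    · rintro ⟨w, hw⟩
      have := LinearMap.congr_fun (pt_D0 cs R A o) w
      rw [Module.End.mul_apply, hw] at this
      change rest cs R A 0 z = 0
      rw [← rest_pt, ← rest_pt, this]
      rfl
  | succ k =>
    constructor
    · rintro ⟨w, hw⟩
      rw [← extt_rest, ← hw]
      exact ⟨_, D_extt cs R A o k w⟩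
    · rintro ⟨w, hw⟩
      refine ⟨rest cs R A k w, ?_⟩
      rw [← rest_D, hw, rest_pt]

end TotalComplex

open Finset
open scoped TensorProduct

section Slices
variable {ι : Type*} [Fintype ι] [DecidableEq ι]
    {Bf : ι → Type*} [∀ j, Fintype (Bf j)] [∀ j, DecidableEq (Bf j)]

/-- The part of `T` in the factor `j`. -/
def kslice (T : Finset ((j : ι) × Bf j)) (j : ι) : Finset (Bf j) :=
  univ.filter (fun b => (⟨j, b⟩ : (j : ι) × Bf j) ∈ T)

lemma mem_kslice {T : Finset ((j : ι) × Bf j)} {j : ι} {b : Bf j} :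
    b ∈ kslice T j ↔ (⟨j, b⟩ : (j : ι) × Bf j) ∈ T := by
  simp [kslice]

lemma sigma_kslice (T : Finset ((j : ι) × Bf j)) : (univ : Finset ι).sigma (kslice T) = T := by
  ext ⟨j, b⟩
  simp [mem_kslice]

lemma kslice_sigma (t : ∀ j, Finset (Bf j)) : kslice ((univ : Finset ι).sigma t) = t := by
  funext j
  ext b
  simp [mem_kslice]

lemma card_kslice (T : Finset ((j : ι) × Bf j)) : T.card = ∑ j, (kslice T j).card := by
  conv_lhs => rw [← sigma_kslice T]
  rw [card_sigma]

lemma kslice_erase_self (T : Finset ((j : ι) × Bf j)) (j : ι) (b : Bf j) :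
    kslice (T.erase ⟨j, b⟩) j = (kslice T j).erase b := by
  ext c
  simp [mem_kslice]

lemma kslice_erase_ne (T : Finset ((j : ι) × Bf j)) (j l : ι) (b : Bf j) (h : l ≠ j) :
    kslice (T.erase ⟨j, b⟩) l = kslice T l := by
  ext c
  simp [mem_kslice, h]

end Slices

section Signs

lemma csgn_eq_prod {B : Type*} [DecidableEq B] (o : LinearOrder B) (T : Finset B) (s : B) :
    csgn o T s = ∏ t ∈ T, (if o.lt t s then (-1 : ℤ) else 1) := by
  let _ := o
  change (-1) ^ (T.filter (fun t => t < s)).card = ∏ t ∈ T, (if t < s then (-1 : ℤ) else 1)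
  rw [prod_ite, prod_const, prod_const_one, mul_one]

open Classical in
/-- A sign comparing two orders. -/
noncomputable def csig {B : Type*} (r r' : B → B → Prop) (T : Finset B) : ℤ :=
  ∏ a ∈ T, ∏ b ∈ T, (if r a b ∧ r' b a then (-1 : ℤ) else 1)

open Classical in
lemma csig_erase {B : Type*} [DecidableEq B] (r r' : B → B → Prop)
    (hr : ∀ a b, a ≠ b → (r a b ↔ ¬ r b a)) (hr' : ∀ a b, a ≠ b → (r' a b ↔ ¬ r' b a))
    (hir : ∀ a, ¬ r a a)
    (T : Finset B) (s : B) (hs : s ∈ T) :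
    csig r r' T = csig r r' (T.erase s) * ((∏ t ∈ T.erase s, (if r t s then (-1 : ℤ) else 1)) *
      ∏ t ∈ T.erase s, (if r' t s then (-1 : ℤ) else 1)) := by
  unfold csig
  rw [← mul_prod_erase T _ hs, ← mul_prod_erase T _ hs]
  have h1 : ∏ x ∈ T.erase s, ∏ b ∈ T, (if r x b ∧ r' b x then (-1 : ℤ) else 1) =
      ∏ x ∈ T.erase s, ((if r x s ∧ r' s x then (-1 : ℤ) else 1) *
        ∏ b ∈ T.erase s, (if r x b ∧ r' b x then (-1 : ℤ) else 1)) :=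
    prod_congr rfl fun x _ =>
      (mul_prod_erase T (fun b => if r x b ∧ r' b x then (-1 : ℤ) else 1) hs).symm
  rw [h1, if_neg (fun h => hir s h.1), one_mul]
  simp only [prod_mul_distrib]
  suffices h2 : (∏ t ∈ T.erase s, (if r s t ∧ r' t s then (-1 : ℤ) else 1)) *
      (∏ t ∈ T.erase s, (if r t s ∧ r' s t then (-1 : ℤ) else 1)) =
      (∏ t ∈ T.erase s, (if r t s then (-1 : ℤ) else 1)) *
      ∏ t ∈ T.erase s, (if r' t s then (-1 : ℤ) else 1) by
    rw [← h2]; ring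
  rw [← prod_mul_distrib, ← prod_mul_distrib]
  refine prod_congr rfl fun t ht => ?_
  have hne : t ≠ s := (mem_erase.1 ht).1
  have a1 := hr t s hne
  have a2 := hr' t s hne
  by_cases c1 : r s t <;> by_cases c2 : r' s t <;> simp [c1, c2, a1, a2]

lemma sq_of_sign {B : Type*} (T : Finset B) (P : B → Prop) [DecidablePred P] :
    (∏ t ∈ T, (if P t then (-1 : ℤ) else 1)) * (∏ t ∈ T, (if P t then (-1 : ℤ) else 1)) = 1 := by
  rw [← prod_mul_distrib]
  refine prod_eq_one fun t _ => ?_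
  split_ifs <;> simp

open Classical in
lemma csig_sq {B : Type*} (r r' : B → B → Prop) (T : Finset B) :
    csig r r' T * csig r r' T = 1 := by
  unfold csig
  rw [← prod_mul_distrib]
  exact prod_eq_one fun t _ => sq_of_sign _ _

variable {ι : Type*} [Fintype ι] [DecidableEq ι]
    {Bf : ι → Type*} [∀ j, Fintype (Bf j)] [∀ j, DecidableEq (Bf j)]

/-- Lexicographic order on the disjoint union. -/
def lexr {n : ℕ} (e : ι ≃ Fin n) (o : ∀ j, LinearOrder (Bf j)) (a b : (j : ι) × Bf j) : Prop :=
  e a.1 < e b.1 ∨ ∃ h : a.1 = b.1, (o b.1).lt (h ▸ a.2) b.2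

lemma lexr_self {n : ℕ} (e : ι ≃ Fin n) (o : ∀ j, LinearOrder (Bf j)) (j : ι) (b c : Bf j) :
    lexr e o ⟨j, b⟩ ⟨j, c⟩ ↔ (o j).lt b c := by
  simp [lexr]

lemma lexr_ne {n : ℕ} (e : ι ≃ Fin n) (o : ∀ j, LinearOrder (Bf j)) (j l : ι) (b : Bf j)
    (c : Bf l) (h : j ≠ l) :
    lexr e o ⟨j, b⟩ ⟨l, c⟩ ↔ e j < e l := by
  simp [lexr, h]

lemma lin_tri {B : Type*} (o : LinearOrder B) (a b : B) (h : a ≠ b) : o.lt a b ↔ ¬ o.lt b a := by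
  let _ := o
  change a < b ↔ ¬ b < a
  rw [not_lt]
  exact ⟨le_of_lt, fun h' => lt_of_le_of_ne h' h⟩

lemma lexr_tri {n : ℕ} (e : ι ≃ Fin n) (o : ∀ j, LinearOrder (Bf j)) (a b : (j : ι) × Bf j)
    (h : a ≠ b) : lexr e o a b ↔ ¬ lexr e o b a := by
  obtain ⟨j, c⟩ := a
  obtain ⟨l, d⟩ := b
  by_cases hjl : j = l
  · subst hjl
    rw [lexr_self, lexr_self]
    exact lin_tri _ _ _ (fun hh => h (by rw [hh]))
  · rw [lexr_ne _ _ _ _ _ _ hjl, lexr_ne _ _ _ _ _ _ (Ne.symm hjl), not_lt]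
    exact ⟨le_of_lt, fun h' => lt_of_le_of_ne h' (fun hh => hjl (e.injective hh))⟩

open Classical in
lemma lex_prod {n : ℕ} (e : ι ≃ Fin n) (o : ∀ j, LinearOrder (Bf j))
    (T : Finset ((j : ι) × Bf j)) (j : ι) (b : Bf j) :
    (∏ t ∈ T.erase ⟨j, b⟩, (if lexr e o t ⟨j, b⟩ then (-1 : ℤ) else 1)) =
      (∏ l, if e l < e j then (-1 : ℤ) ^ (kslice T l).card else 1) *
        csgn (o j) ((kslice T j).erase b) b := by
  rw [← sigma_kslice (T.erase ⟨j, b⟩), prod_sigma, csgn_eq_prod]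
  rw [← mul_prod_erase univ _ (mem_univ j),
    ← mul_prod_erase univ (fun l => if e l < e j then (-1 : ℤ) ^ (kslice T l).card else 1)
      (mem_univ j), if_neg (lt_irrefl _), one_mul, mul_comm, kslice_erase_self]
  congr 1
  · refine prod_congr rfl fun l hl => ?_
    have hl : l ≠ j := (mem_erase.1 hl).1
    rw [kslice_erase_ne _ _ _ _ hl]
    simp only [lexr_ne _ _ _ _ _ _ hl]
    rw [prod_const]
    split_ifs <;> simp
  · refine prod_congr rfl fun c _ => ?_
    simp only [lexr_self]

/-- The comparison sign. -/
noncomputable def ksig {n : ℕ} (e : ι ≃ Fin n) (o : ∀ j, LinearOrder (Bf j))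
    (o' : LinearOrder ((j : ι) × Bf j)) (T : Finset ((j : ι) × Bf j)) : ℤ :=
  csig (lexr e o) o'.lt T

lemma ksig_erase {n : ℕ} (e : ι ≃ Fin n) (o : ∀ j, LinearOrder (Bf j))
    (o' : LinearOrder ((j : ι) × Bf j)) (T : Finset ((j : ι) × Bf j)) (j : ι) (b : Bf j)
    (h : (⟨j, b⟩ : (j : ι) × Bf j) ∈ T) :
    csgn o' (T.erase ⟨j, b⟩) ⟨j, b⟩ * ksig e o o' (T.erase ⟨j, b⟩) =
      ksig e o o' T * ((∏ l, if e l < e j then (-1 : ℤ) ^ (kslice T l).card else 1) *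
        csgn (o j) ((kslice T j).erase b) b) := by
  classical
  rw [← lex_prod e o, ksig, ksig, csig_erase _ _ (lexr_tri e o) (lin_tri o') _ T _ h,
    csgn_eq_prod]
  · have hsq := sq_of_sign (T.erase ⟨j, b⟩) (fun t => lexr e o t ⟨j, b⟩)
    have hd : (∏ t ∈ T.erase ⟨j, b⟩, (if o'.lt t ⟨j, b⟩ then (-1 : ℤ) else 1)) =
      (∏ t ∈ T.erase ⟨j, b⟩, @ite _ (o'.lt t ⟨j, b⟩) (Classical.propDecidable _) (-1 : ℤ) 1) :=
      prod_congr rfl fun t _ => by congr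
    rw [hd]
    linear_combination (- csig (lexr e o) o'.lt (T.erase ⟨j, b⟩) *
      (∏ t ∈ T.erase ⟨j, b⟩, @ite _ (o'.lt t ⟨j, b⟩) (Classical.propDecidable _) (-1 : ℤ) 1)) * hsq
  · rintro ⟨l, c⟩
    rw [lexr_self]
    let _ := o l
    exact lt_irrefl c

end Signs

open Finset
open scoped TensorProduct

section Eval
variable {B : Type*} [DecidableEq B] [Fintype B]
variable {W : Type*} [Group W] {M : CoxeterMatrix B} (cs : CoxeterSystem M W)
variable (R : Type*) [CommRing R] (A : Type*) [AddCommGroup A] [Module R A]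
  [DistribMulAction W A] [SMulCommClass W R A]

/-- Evaluation at `T`. -/
def evt (T : Finset B) : Xt cs R A →ₗ[R] A := (LinearMap.proj T).comp (Xt cs R A).subtype

lemma evt_apply (T : Finset B) (x : Xt cs R A) : evt cs R A T x = x.1 T := rfl

lemma exists_cpt (K : Type*) [Field K] [Module K A] [SMulCommClass W K A] (T : Finset B) :
    ∃ c : A →ₗ[K] Xt cs K A, (∀ v T', T' ≠ T → (c v).1 T' = 0) ∧
      (∀ v ∈ Fsub cs K A T, (c v).1 T = v) := by
  obtain ⟨g, hg⟩ := LinearMap.exists_leftInverse_of_injective (Fsub cs K A T).subtype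
    (Submodule.ker_subtype _)
  have hmem : ∀ v, Pi.single (M := fun _ : Finset B => A) T (g v : A) ∈ Xt cs K A := by
    intro v T'
    by_cases h : T' = T
    · subst h
      rw [Pi.single_eq_same]
      exact (g v).2
    · rw [Pi.single_eq_of_ne h]
      exact zero_mem _
  refine ⟨LinearMap.codRestrict _ ((LinearMap.single K (fun _ : Finset B => A) T) ∘ₗ
    (Fsub cs K A T).subtype ∘ₗ g) hmem, fun v T' h => ?_, fun v hv => ?_⟩
  · exact Pi.single_eq_of_ne h _
  · have h1 := LinearMap.congr_fun hg ⟨v, hv⟩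
    change Pi.single (M := fun _ : Finset B => A) T (g v : A) T = v
    rw [Pi.single_eq_same]
    exact congrArg Subtype.val h1

end Eval

lemma tprod_zsmul {ι : Type*} [Fintype ι] [DecidableEq ι] (K : Type*) [Field K]
    (Vf : ι → Type*) [∀ j, AddCommGroup (Vf j)] [∀ j, Module K (Vf j)] (c : ι → ℤ)
    (w : ∀ j, Vf j) :
    PiTensorProduct.tprod K (fun j => c j • w j) =
      ((∏ j, c j : ℤ) : K) • PiTensorProduct.tprod K w := by
  have h := (PiTensorProduct.tprod K (s := Vf)).map_smul_univ (fun j => ((c j : ℤ) : K)) w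
  simp only [Int.cast_smul_eq_zsmul] at h
  rw [h, ← Int.cast_prod]

section Product
variable {ι : Type*} [Fintype ι] [DecidableEq ι] (K : Type*) [Field K]
    {Bf : ι → Type*} [∀ j, Fintype (Bf j)] [∀ j, DecidableEq (Bf j)]
    {Wf : ι → Type*} [∀ j, Group (Wf j)]
    {Mf : ∀ j, CoxeterMatrix (Bf j)} (cs : ∀ j, CoxeterSystem (Mf j) (Wf j))
    (o : ∀ j, LinearOrder (Bf j))
    (Vf : ι → Type*) [∀ j, AddCommGroup (Vf j)] [∀ j, Module K (Vf j)]
    [∀ j, DistribMulAction (Wf j) (Vf j)] [∀ j, SMulCommClass (Wf j) K (Vf j)]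
    {M' : CoxeterMatrix ((j : ι) × Bf j)} (cs' : CoxeterSystem M' (∀ j, Wf j))
    (hsimple : ∀ (j : ι) (b : Bf j),
      cs'.simple ⟨j, b⟩ = Pi.mulSingle j ((cs j).simple b))
    (o' : LinearOrder ((j : ι) × Bf j)) {n : ℕ} (e : ι ≃ Fin n)

include hsimple in
lemma indep_iff (T : Finset ((j : ι) × Bf j)) :
    Indep cs' T ↔ ∀ j, Indep (cs j) (kslice T j) := by
  constructor
  · intro h j a ha b hb hab
    have h1 := h ⟨j, a⟩ (mem_kslice.1 ha) ⟨j, b⟩ (mem_kslice.1 hb) (by simpa using hab)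
    rw [hsimple, hsimple] at h1
    have h2 := h1.map (Pi.evalMonoidHom Wf j)
    simpa using h2
  · rintro h ⟨j, a⟩ ha ⟨l, b⟩ hb hab
    rw [hsimple, hsimple]
    by_cases hjl : j = l
    · subst hjl
      exact (h j a (mem_kslice.2 ha) b (mem_kslice.2 hb) (by rintro rfl; exact hab rfl)).map
        (MonoidHom.mulSingle Wf j)
    · exact Pi.mulSingle_commute hjl _ _

include hsimple in
lemma simple_tprod (j : ι) (b : Bf j) (v : ∀ j, Vf j) :
    cs'.simple ⟨j, b⟩ • PiTensorProduct.tprod K v =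
      PiTensorProduct.tprod K (Function.update v j ((cs j).simple b • v j)) := by
  rw [hsimple]
  change PiTensorProduct.map _ (PiTensorProduct.tprod K v) = _
  rw [PiTensorProduct.map_tprod]
  congr 1
  funext l
  by_cases h : l = j
  · subst h
    simp only [Pi.mulSingle_eq_same, Function.update_self]
    rfl
  · simp only [Pi.mulSingle_eq_of_ne h, Function.update_of_ne h]
    exact one_smul _ _

include hsimple in
lemma simple_map (j : ι) (b : Bf j) (x : ⨂[K] j, Vf j) :
    cs'.simple ⟨j, b⟩ • x =
      PiTensorProduct.map (Function.update (fun l => (1 : Module.End K (Vf l))) j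
        (DistribMulAction.toLinearMap K (Vf j) ((cs j).simple b))) x := by
  rw [hsimple]
  change PiTensorProduct.map _ x = _
  congr 2
  funext l
  by_cases h : l = j
  · subst h
    simp
  · refine LinearMap.ext fun v => ?_
    simp only [Pi.mulSingle_eq_of_ne h, Function.update_of_ne h]
    exact one_smul _ _

lemma upd_mul (j : ι) (a b : Module.End K (Vf j)) :
    PiTensorProduct.map (Function.update (fun l => (1 : Module.End K (Vf l))) j (a * b)) =
      PiTensorProduct.map (Function.update (fun l => (1 : Module.End K (Vf l))) j a) ∘ₗ
      PiTensorProduct.map (Function.update (fun l => (1 : Module.End K (Vf l))) j b) := by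
  rw [← PiTensorProduct.map_comp]
  congr 1
  funext l
  by_cases h : l = j
  · subst h
    simp [Module.End.mul_eq_comp]
  · simp [h, Module.End.one_eq_id]

include hsimple in
lemma map_fix_one (j : ι) (t : Finset (Bf j)) (N : Module.End K (Vf j))
    (hN : ∀ w ∈ invSub (cs j) K (Vf j) t, N w = w) (v : ⨂[K] j, Vf j)
    (hv : ∀ b ∈ t, cs'.simple ⟨j, b⟩ • v = v) :
    PiTensorProduct.map (Function.update (fun l => (1 : Module.End K (Vf l))) j N) v = v := by
  let ρ : Bf j → Module.End K (Vf j) := fun b =>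
    DistribMulAction.toLinearMap K (Vf j) ((cs j).simple b)
  let L : Module.End K (Vf j) →ₗ[K] Module.End K (⨂[K] j, Vf j) :=
    (PiTensorProduct.mapMultilinear K Vf Vf).toLinearMap (fun l => (1 : Module.End K (Vf l))) j
  have hL : ∀ a, L a =
    PiTensorProduct.map (Function.update (fun l => (1 : Module.End K (Vf l))) j a) := fun a => rfl
  have hL1 : L 1 = 1 := by
    rw [hL, Function.update_eq_self]
    exact PiTensorProduct.map_one
  have hLm : ∀ a b, L (a * b) = L a * L b := fun a b => upd_mul K Vf j a b
  let φ : Vf j →ₗ[K] (t → Vf j) := LinearMap.pi (fun b => ρ b.1 - 1)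
  obtain ⟨g, hg⟩ := exists_ginv φ
  have hN' : N = 1 - ∑ b : t, ((1 - N) * (g ∘ₗ LinearMap.single K (fun _ : t => Vf j) b)) *
      (ρ b.1 - 1) := by
    refine LinearMap.ext fun w => ?_
    have h1 : ∑ b : t, (((1 - N) * (g ∘ₗ LinearMap.single K (fun _ : t => Vf j) b)) *
      (ρ b.1 - 1)) w = (1 - N) (g (φ w)) := by
      conv_rhs => rw [← LinearMap.sum_single_apply (fun _ : t => Vf j) (φ w)]
      rw [map_sum, map_sum]
      rfl
    rw [LinearMap.sub_apply, LinearMap.sum_apply, h1]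
    have h2 : N (w - g (φ w)) = w - g (φ w) := by
      apply hN
      intro b hb
      have h3 : φ (w - g (φ w)) = 0 := by rw [map_sub, hg, sub_self]
      have h4 := congrFun h3 ⟨b, hb⟩
      exact sub_eq_zero.1 h4
    rw [map_sub] at h2
    change N w = w - (g (φ w) - N (g (φ w)))
    rw [← sub_eq_zero] at h2 ⊢
    rw [← h2]
    abel
  change L N v = v
  rw [hN', map_sub, map_sum, hL1, LinearMap.sub_apply, LinearMap.sum_apply, sum_eq_zero, sub_zero]
  · rfl
  · intro b _
    rw [hLm, map_sub, hL1, Module.End.mul_apply, LinearMap.sub_apply]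
    have : L (ρ b.1) v = v := by
      rw [hL, ← simple_map K cs Vf cs' hsimple]
      exact hv b.1 b.2
    rw [this]
    simp

include hsimple in
lemma map_fix (t : ∀ j, Finset (Bf j)) (N : ∀ j, Module.End K (Vf j))
    (hN : ∀ j, ∀ w ∈ invSub (cs j) K (Vf j) (t j), N j w = w) (v : ⨂[K] j, Vf j)
    (hv : ∀ j, ∀ b ∈ t j, cs'.simple ⟨j, b⟩ • v = v) :
    PiTensorProduct.map N v = v := by
  have key : ∀ s : Finset ι,
      PiTensorProduct.map (fun l => if l ∈ s then N l else (1 : Module.End K (Vf l))) v = v := by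
    intro s
    induction s using Finset.induction_on with
    | empty =>
      have := PiTensorProduct.map_one (R := K) (s := Vf)
      simp [this]
    | insert j s hj ih =>
      have h : (fun l => if l ∈ insert j s then N l else (1 : Module.End K (Vf l))) =
        fun l => (Function.update (fun l => (1 : Module.End K (Vf l))) j (N j) l) ∘ₗ
          (if l ∈ s then N l else (1 : Module.End K (Vf l))) := by
        funext l
        by_cases h : l = j
        · subst h
          simp [hj, Module.End.one_eq_id]
        · simp [h, Module.End.one_eq_id]
      rw [h, PiTensorProduct.map_comp, LinearMap.comp_apply, ih]
      exact map_fix_one K cs Vf cs' hsimple j (t j) (N j) (hN j) v (hv j)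
  simpa using key univ

/-- Components of the comparison map. -/
noncomputable def mu0 (T : Finset ((j : ι) × Bf j)) :
    (⨂[K] j, Xt (cs j) K (Vf j)) →ₗ[K] ⨂[K] j, Vf j :=
  (ksig e o o' T : K) • PiTensorProduct.map (fun j => evt (cs j) K (Vf j) (kslice T j))

lemma mu0_tprod (T : Finset ((j : ι) × Bf j)) (x : ∀ j, Xt (cs j) K (Vf j)) :
    mu0 K cs o Vf o' e T (PiTensorProduct.tprod K x) =
      (ksig e o o' T : K) • PiTensorProduct.tprod K (fun j => (x j).1 (kslice T j)) := by
  rw [mu0, LinearMap.smul_apply, PiTensorProduct.map_tprod]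
  rfl

include hsimple in
lemma mu_mem (x : ⨂[K] j, Xt (cs j) K (Vf j)) :
    LinearMap.pi (mu0 K cs o Vf o' e) x ∈ Xt cs' K (⨂[K] j, Vf j) := by
  induction x using PiTensorProduct.induction_on with
  | smul_tprod r x =>
    rw [map_smul]
    refine Submodule.smul_mem _ _ fun T => ?_
    rw [LinearMap.pi_apply, mu0_tprod]
    refine Submodule.smul_mem _ _ (show _ ∧ _ from ⟨?_, ?_⟩)
    · rintro ⟨j, b⟩ hb
      rw [simple_tprod K cs Vf cs' hsimple, ((x j).2 _).1 b (mem_kslice.2 hb)]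
      rw [Function.update_eq_self_iff.2 rfl]
    · intro h
      rw [indep_iff cs cs' hsimple] at h
      push Not at h
      obtain ⟨j, hj⟩ := h
      exact (PiTensorProduct.tprod K).map_coord_zero j (Xt_not (cs j) hj)
  | add x y hx hy =>
    rw [map_add]
    exact add_mem hx hy

/-- The comparison map. -/
noncomputable def mu : (⨂[K] j, Xt (cs j) K (Vf j)) →ₗ[K] Xt cs' K (⨂[K] j, Vf j) :=
  LinearMap.codRestrict _ (LinearMap.pi (mu0 K cs o Vf o' e)) (mu_mem K cs o Vf cs' hsimple o' e)

lemma mu_apply (x : ⨂[K] j, Xt (cs j) K (Vf j)) (T : Finset ((j : ι) × Bf j)) :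
    (mu K cs o Vf cs' hsimple o' e x).1 T =
      (ksig e o o' T : K) • PiTensorProduct.map (fun j => evt (cs j) K (Vf j) (kslice T j)) x := rfl

lemma mu_tprod (x : ∀ j, Xt (cs j) K (Vf j)) (T : Finset ((j : ι) × Bf j)) :
    (mu K cs o Vf cs' hsimple o' e (PiTensorProduct.tprod K x)).1 T =
      (ksig e o o' T : K) • PiTensorProduct.tprod K (fun j => (x j).1 (kslice T j)) :=
  mu0_tprod K cs o Vf o' e T x

lemma mu_bij : Function.Bijective (mu K cs o Vf cs' hsimple o' e) := by
  choose c hc0 hc1 using fun j => exists_cpt (cs j) (Vf j) K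
  let ν : Xt cs' K (⨂[K] j, Vf j) →ₗ[K] ⨂[K] j, Xt (cs j) K (Vf j) :=
    ∑ t : ∀ j, Finset (Bf j), (ksig e o o' ((univ : Finset ι).sigma t) : K) •
      (PiTensorProduct.map (fun j => c j (t j)) ∘ₗ evt cs' K _ ((univ : Finset ι).sigma t))
  have hν : ∀ y, ν y = ∑ t : ∀ j, Finset (Bf j), (ksig e o o' ((univ : Finset ι).sigma t) : K) •
      (PiTensorProduct.map (fun j => c j (t j)) (y.1 ((univ : Finset ι).sigma t))) := by
    intro y
    simp only [ν, LinearMap.sum_apply]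
    rfl
  constructor
  · have h : ν ∘ₗ (mu K cs o Vf cs' hsimple o' e) = LinearMap.id := by
      refine PiTensorProduct.ext (MultilinearMap.ext fun x => ?_)
      rw [LinearMap.compMultilinearMap_apply, LinearMap.compMultilinearMap_apply,
        LinearMap.comp_apply, hν, LinearMap.id_apply]
      have hx : x = fun j => ∑ T : Finset (Bf j), c j T ((x j).1 T) := by
        funext j
        refine Xt_ext (cs j) fun T => ?_
        rw [Submodule.coe_sum, Finset.sum_apply, sum_eq_single T]
        · exact (hc1 j T _ ((x j).2 T)).symm
        · intro T' _ h
          exact hc0 j T' _ T (Ne.symm h)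
        · simp
      conv_rhs => rw [hx, MultilinearMap.map_sum]
      refine sum_congr rfl fun t _ => ?_
      rw [mu_tprod, map_smul, smul_smul, kslice_sigma, PiTensorProduct.map_tprod]
      rw [← Int.cast_mul, ksig, csig_sq, Int.cast_one, one_smul]
    exact Function.LeftInverse.injective (g := ν) (fun x => LinearMap.congr_fun h x)
  · refine Function.RightInverse.surjective (g := ν) fun y => ?_
    refine Xt_ext cs' fun T => ?_
    rw [mu_apply, hν, map_sum, sum_eq_single (kslice T)]
    · rw [sigma_kslice, map_smul, smul_smul, ← Int.cast_mul, ksig, csig_sq, Int.cast_one, one_smul]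
      by_cases hT : Indep cs' T
      · rw [← LinearMap.comp_apply, ← PiTensorProduct.map_comp]
        have hT' := (indep_iff cs cs' hsimple T).1 hT
        refine map_fix K cs Vf cs' hsimple (kslice T) _ (fun j w hw => ?_) _ (fun j b hb => ?_)
        · exact hc1 j _ w ⟨hw, fun h => absurd (hT' j) h⟩
        · exact (y.2 T).1 _ (mem_kslice.1 hb)
      · rw [Xt_not cs' hT]
        simp
    · intro t _ ht
      obtain ⟨j, hj⟩ := Function.ne_iff.1 ht
      rw [map_smul, ← LinearMap.comp_apply, ← PiTensorProduct.map_comp, ptmap_zero j]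
      · simp
      · refine LinearMap.ext fun w => ?_
        exact hc0 j _ _ _ (Ne.symm hj)
    · simp

lemma mu_D (x : ⨂[K] j, Xt (cs j) K (Vf j)) :
    Dt cs' K _ o' (mu K cs o Vf cs' hsimple o' e x) = mu K cs o Vf cs' hsimple o' e
      ((∑ j, PiTensorProduct.map (fun l => if e l < e j then Et (cs l) K (Vf l) else
        if l = j then Dt (cs l) K (Vf l) (o l) else 1)) x) := by
  have key : Dt cs' K _ o' ∘ₗ (mu K cs o Vf cs' hsimple o' e) = mu K cs o Vf cs' hsimple o' e ∘ₗ
      (∑ j, PiTensorProduct.map (fun l => if e l < e j then Et (cs l) K (Vf l) else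
        if l = j then Dt (cs l) K (Vf l) (o l) else 1)) := by
    refine PiTensorProduct.ext (MultilinearMap.ext fun x => ?_)
    rw [LinearMap.compMultilinearMap_apply, LinearMap.compMultilinearMap_apply,
      LinearMap.comp_apply, LinearMap.comp_apply]
    refine Xt_ext cs' fun T => ?_
    by_cases hT : Indep cs' T
    swap
    · rw [Xt_not cs' hT, Xt_not cs' hT]
    have hT' := (indep_iff cs cs' hsimple T).1 hT
    rw [Dt_apply cs' o' _ T hT, LinearMap.sum_apply, map_sum, Submodule.coe_sum, Finset.sum_apply]
    conv_lhs =>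
      enter [1]
      rw [← sigma_kslice T]
    rw [sum_sigma]
    refine sum_congr rfl fun j _ => ?_
    rw [PiTensorProduct.map_tprod, mu_tprod]
    let P : ∀ l, Vf l := fun l => (x l).1 (kslice T l)
    let c : ι → ℤ := fun l => if e l < e j then (-1 : ℤ) ^ (kslice T l).card else 1
    have hR : (fun l => ((if e l < e j then Et (cs l) K (Vf l) else
        if l = j then Dt (cs l) K (Vf l) (o l) else 1) (x l)).1 (kslice T l)) =
        fun l => c l • Function.update P j ((Dt (cs j) K (Vf j) (o j) (x j)).1 (kslice T j)) l := by
      funext l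
      by_cases h : l = j
      · subst h
        simp [c]
      · by_cases h2 : e l < e j
        · simp only [c, h, h2, if_true, ne_eq, not_false_eq_true, Function.update_of_ne]
          rfl
        · simp only [c, h, h2, if_false, ne_eq, not_false_eq_true, Function.update_of_ne, one_smul]
          rfl
    rw [hR, tprod_zsmul, Dt_apply (cs j) (o j) _ _ (hT' j), MultilinearMap.map_update_sum,
      smul_sum, smul_sum]
    refine sum_congr rfl fun b hb => ?_
    have hz : ∀ (z : ℤ) (w : Vf j), PiTensorProduct.tprod K (Function.update P j (z • w)) =
        (z : K) • PiTensorProduct.tprod K (Function.update P j w) := by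
      intro z w
      rw [← Int.cast_smul_eq_zsmul K, MultilinearMap.map_update_smul]
    have hP : (fun l => (x l).1 (kslice (T.erase ⟨j, b⟩) l)) =
        Function.update P j ((x j).1 ((kslice T j).erase b)) := by
      funext l
      by_cases h : l = j
      · subst h
        rw [Function.update_self, kslice_erase_self]
      · rw [Function.update_of_ne h, kslice_erase_ne _ _ _ _ h]
    rw [mu_tprod, hz, hP, smul_comm (cs'.simple _), simple_tprod K cs Vf cs' hsimple,
      ← smul_add, ← Int.cast_smul_eq_zsmul K, smul_smul, ← Int.cast_mul, ksig_erase e o o' T j b (mem_kslice.1 hb), Function.update_self,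
      Function.update_idem, ← MultilinearMap.map_update_add, smul_smul, smul_smul,
      Int.cast_mul, Int.cast_mul, mul_assoc]
  exact LinearMap.congr_fun key x

lemma mu_deg (i : ℕ) (f : ι → ℕ) (x : ⨂[K] j, Xt (cs j) K (Vf j)) :
    pt cs' K _ i (mu K cs o Vf cs' hsimple o' e
      (PiTensorProduct.map (fun j => pt (cs j) K (Vf j) (f j)) x)) =
    if ∑ j, f j = i then mu K cs o Vf cs' hsimple o' e
      (PiTensorProduct.map (fun j => pt (cs j) K (Vf j) (f j)) x) else 0 := by
  have key : ∀ T : Finset ((j : ι) × Bf j), T.card ≠ ∑ j, f j →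
      (mu K cs o Vf cs' hsimple o' e
      (PiTensorProduct.map (fun j => pt (cs j) K (Vf j) (f j)) x)).1 T = 0 := by
    intro T hT
    have : ∃ j, (kslice T j).card ≠ f j := by
      by_contra h
      push Not at h
      exact hT (by rw [card_kslice]; simp [h])
    obtain ⟨j, hj⟩ := this
    rw [mu_apply, ← LinearMap.comp_apply, ← PiTensorProduct.map_comp, ptmap_zero j]
    · simp
    · refine LinearMap.ext fun w => ?_
      rw [LinearMap.comp_apply, evt_apply, pt_apply, if_neg hj]
      rfl
  refine Xt_ext cs' fun T => ?_
  rw [pt_apply]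
  by_cases hi : ∑ j, f j = i
  · rw [if_pos hi]
    split_ifs with h
    · rfl
    · exact (key T (by rw [hi]; exact h)).symm
  · rw [if_neg hi]
    split_ifs with h
    · rw [key T (by rw [h]; exact Ne.symm hi)]
      rfl
    · rfl

end Product

section Statement

open scoped TensorProduct DirectSum

/-- Künneth formula: let `(Gⱼ, Sⱼ)` (`j ∈ ι`) be Coxeter systems, `Vⱼ` a
representation of `Gⱼ` over a field `K`, and let `G = Π Gⱼ` be the product Coxeter system,
whose generating set is the disjoint union of the `Sⱼ` (with generators from distinct factors
commuting), acting on the external tensor product `V = V₁ ⊠ ⋯ ⊠ Vₙ`.  Then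
`H^i_C(G,V) ≅ ⊕_{i₁+⋯+iₙ=i} H^{i₁}_C(G₁,V₁) ⊗ ⋯ ⊗ H^{iₙ}_C(Gₙ,Vₙ)`. -/
theorem coxeter_cohomology_kunneth
    {ι : Type*} [Fintype ι] [DecidableEq ι] (K : Type*) [Field K]
    {Bf : ι → Type*} [∀ j, Fintype (Bf j)] [∀ j, DecidableEq (Bf j)]
    {Wf : ι → Type*} [∀ j, Group (Wf j)]
    {Mf : ∀ j, CoxeterMatrix (Bf j)} (cs : ∀ j, CoxeterSystem (Mf j) (Wf j))
    (o : ∀ j, LinearOrder (Bf j))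
    (Vf : ι → Type*) [∀ j, AddCommGroup (Vf j)] [∀ j, Module K (Vf j)]
    [∀ j, DistribMulAction (Wf j) (Vf j)] [∀ j, SMulCommClass (Wf j) K (Vf j)]
    {M' : CoxeterMatrix ((j : ι) × Bf j)} (cs' : CoxeterSystem M' (∀ j, Wf j))
    (hsimple : ∀ (j : ι) (b : Bf j),
      cs'.simple ⟨j, b⟩ = Pi.mulSingle j ((cs j).simple b))
    (o' : LinearOrder ((j : ι) × Bf j)) (i : ℕ) :
    Nonempty (CoxH cs' K (⨂[K] j, Vf j) o' i ≃ₗ[K]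
      ⨁ (f : {f : ι → ℕ // ∑ j, f j = i}),
        ⨂[K] j, CoxH (cs j) K (Vf j) (o j) (f.1 j)) := by
  let e := Fintype.equivFin ι
  refine abstract_kunneth (X' := Xt cs' K (⨂[K] j, Vf j))
    (H' := CoxH cs' K (⨂[K] j, Vf j) o' i) e (fun j => Dt (cs j) K (Vf j) (o j)) (fun j => pt (cs j) K (Vf j))
    (fun j => Fintype.card (Bf j) + 1) (fun j => Dt_D (cs j) K (Vf j) (o j))
    (fun j => pt_mul (cs j) K (Vf j)) (fun j => pt_sum (cs j) K (Vf j))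
    (fun j => pt_D (cs j) K (Vf j) (o j)) (fun j => pt_D0 (cs j) K (Vf j) (o j))
    (fun j k => CoxH (cs j) K (Vf j) (o j) k) (fun j k => qt (cs j) K (Vf j) (o j) k)
    (fun j k => qt_surj (cs j) K (Vf j) (o j) k) (fun j k => qt_zero (cs j) K (Vf j) (o j) k)
    (fun j => Et (cs j) K (Vf j)) (fun j => pt_E (cs j) K (Vf j)) (fun j => Et_E (cs j) K (Vf j))
    (Dt cs' K (⨂[K] j, Vf j) o') (pt cs' K (⨂[K] j, Vf j) i) ?_ (qt cs' K (⨂[K] j, Vf j) o' i) (qt_surj cs' K (⨂[K] j, Vf j) o' i)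
    (qt_zero cs' K (⨂[K] j, Vf j) o' i) (LinearEquiv.ofBijective _ (mu_bij K cs o Vf cs' hsimple o' e))
    (mu_D K cs o Vf cs' hsimple o' e) i (mu_deg K cs o Vf cs' hsimple o' e i)
  intro y
  cases i with
  | zero =>
    have h := LinearMap.congr_fun (pt_D0 cs' K (⨂[K] j, Vf j) o') y
    rw [Module.End.mul_apply] at h
    rw [h]
    exact zero_mem _
  | succ k =>
    have h := LinearMap.congr_fun (pt_D cs' K (⨂[K] j, Vf j) o' k) y
    rw [Module.End.mul_apply] at h
    rw [h]
    exact ⟨_, rfl⟩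

end Statement
end

section
/- Let K be a field of characteristic ≠ 2, regarded as a trivial module over the Coxeter group A_n. Then for all n ≥ 1 and i ≥ 0, dim_K H_C^i(A_n, K) = 1 if n ∈ {3i−1, 3i}, and dim_K H_C^i(A_n, K) = 0 otherwise. -/
set_option linter.unusedSectionVars false

open Finset

namespace PathInd

/-- Independent subsets of the path on `range m`. -/
def Ind (m : ℕ) (T : Finset ℕ) : Prop := (∀ t ∈ T, t < m) ∧ ∀ t ∈ T, t + 1 ∉ T

variable {K : Type*} [Field K] (σ : Finset ℕ → ℕ → K)

/-- The weighted differential. -/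
def dd (x : Finset ℕ → K) (U : Finset ℕ) : K := ∑ s ∈ U, σ (U.erase s) s * x (U.erase s)

def Cocyc (m i : ℕ) (x : Finset ℕ → K) : Prop :=
  ∀ U, Ind m U → U.card = i + 1 → dd σ x U = 0

def Cobd (m i : ℕ) (x : Finset ℕ → K) : Prop :=
  ∃ y, ∀ U, Ind m U → U.card = i → x U = dd σ y U

def Acyc (m i : ℕ) : Prop := ∀ x, Cocyc σ m i x → Cobd σ m i x

def OneDim (m i : ℕ) : Prop :=
  ∃ g, Cocyc σ m i g ∧ ¬ Cobd σ m i g ∧ ∀ x, Cocyc σ m i x → ∃ c : K, Cobd σ m i (x - c • g)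

lemma dd_add (x y : Finset ℕ → K) (U) : dd σ (x + y) U = dd σ x U + dd σ y U := by
  simp [dd, mul_add, Finset.sum_add_distrib]

lemma dd_smul (c : K) (y : Finset ℕ → K) (U) : dd σ (c • y) U = c * dd σ y U := by
  simp only [dd, Pi.smul_apply, smul_eq_mul, Finset.mul_sum]
  exact Finset.sum_congr rfl fun _ _ => by ring

lemma dd_sub (x y : Finset ℕ → K) (U) : dd σ (x - y) U = dd σ x U - dd σ y U := by
  simp [dd, mul_sub, Finset.sum_sub_distrib]

lemma dd_congr {x y : Finset ℕ → K} {U} (h : ∀ s ∈ U, x (U.erase s) = y (U.erase s)) :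
    dd σ x U = dd σ y U :=
  Finset.sum_congr rfl fun s hs => by rw [h s hs]

lemma dd_insert (x : Finset ℕ → K) {T : Finset ℕ} {a : ℕ} (ha : a ∉ T) :
    dd σ x (insert a T) = σ T a * x T +
      ∑ s ∈ T, σ (insert a (T.erase s)) s * x (insert a (T.erase s)) := by
  unfold dd
  rw [Finset.sum_insert ha, Finset.erase_insert ha]
  congr 1
  refine Finset.sum_congr rfl fun s hs => ?_
  have : a ≠ s := fun h => ha (h ▸ hs)
  rw [Finset.erase_insert_of_ne this]

/-- contraction with `a`. -/
def con (a : ℕ) (x : Finset ℕ → K) (T : Finset ℕ) : K := (σ T a)⁻¹ * x (insert a T)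

variable (h0 : ∀ T s, σ T s ≠ 0)
  (hσ : ∀ T s t, s ∉ T → t ∉ T → s ≠ t →
    σ T s * σ (insert s T) t = - (σ T t * σ (insert t T) s))

include h0 hσ

lemma con_dd (x : Finset ℕ → K) {T : Finset ℕ} {a : ℕ} (ha : a ∉ T) :
    con σ a (dd σ x) T = x T - dd σ (con σ a x) T := by
  unfold con
  rw [dd_insert σ x ha, mul_add, ← mul_assoc, inv_mul_cancel₀ (h0 _ _), one_mul, sub_eq_add_neg]
  congr 1
  unfold dd
  rw [Finset.mul_sum, ← Finset.sum_neg_distrib]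
  refine Finset.sum_congr rfl fun s hs => ?_
  have hne : a ≠ s := fun h => ha (h ▸ hs)
  have := hσ (T.erase s) s a (by simp) (by simp [ha]) hne.symm
  rw [Finset.insert_erase hs] at this
  have h1 := h0 T a
  have h2 := h0 (T.erase s) a
  field_simp
  linear_combination (x (insert a (T.erase s))) * this

omit h0 hσ in
lemma Ind.erase {m U} (h : Ind m U) (s : ℕ) : Ind m (U.erase s) :=
  ⟨fun t ht => h.1 t (Finset.mem_of_mem_erase ht), fun t ht ht' =>
    h.2 t (Finset.mem_of_mem_erase ht) (Finset.mem_of_mem_erase ht')⟩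

omit h0 hσ in
lemma Ind.insert {k m U} (h : Ind k U) (a : ℕ) (ha : k < a + 1) (hk : ∀ t ∈ U, t + 1 < a)
    (ham : a < m) : Ind m (insert a U) := by
  refine ⟨fun t ht => ?_, fun t ht ht' => ?_⟩
  · rcases Finset.mem_insert.1 ht with rfl | ht
    · exact ham
    · have := hk t ht; omega
  · rcases Finset.mem_insert.1 ht with rfl | ht <;> rcases Finset.mem_insert.1 ht' with h' | ht'
    · omega
    · have := hk _ ht'; omega
    · have := hk _ ht; omega
    · exact h.2 t ht ht'

def rho (m : ℕ) (x : Finset ℕ → K) : Finset ℕ → K := con σ m x - con σ (m + 1) x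

/-- the section -/
def lft (m : ℕ) (z : Finset ℕ → K) (U : Finset ℕ) : K :=
  if m ∈ U then σ (U.erase m) m * z (U.erase m) else 0

lemma rho_dd (m : ℕ) (x : Finset ℕ → K) {T} (hT : ∀ t ∈ T, t < m) :
    rho σ m (dd σ x) T = - dd σ (rho σ m x) T := by
  have ha : m ∉ T := fun h => by have := hT _ h; omega
  have hb : m + 1 ∉ T := fun h => by have := hT _ h; omega
  simp only [rho, Pi.sub_apply, con_dd σ h0 hσ x ha, con_dd σ h0 hσ x hb, dd_sub]
  ring

lemma rho_lft (m : ℕ) (z : Finset ℕ → K) {T} (hT : ∀ t ∈ T, t < m) :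
    rho σ m (lft σ m z) T = z T := by
  have ha : m ∉ T := fun h => by have := hT _ h; omega
  have := h0 T m
  simp [rho, con, lft, ha, this]

/-- A set in `Ind (m+2)` containing `m` -/
lemma ind_b {m U} (h : Ind (m + 2) U) (hm : m ∈ U) :
    Ind (m - 1) (U.erase m) := by
  refine ⟨fun t ht => ?_, (h.erase m).2⟩
  have h1 := h.1 t (Finset.mem_of_mem_erase ht)
  have h2 := h.2 t (Finset.mem_of_mem_erase ht)
  have h3 := Finset.ne_of_mem_erase ht
  have h4 := h.2 m hm
  have : t ≠ m + 1 := fun e => h4 (e ▸ Finset.mem_of_mem_erase ht)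
  have : t + 1 ≠ m := fun e => h2 (e ▸ hm)
  omega

lemma lft_cocyc {m i : ℕ} {z : Finset ℕ → K} (hz : Cocyc σ (m - 1) i z) :
    Cocyc σ (m + 2) (i + 1) (lft σ m z) := by
  intro U hU hc
  by_cases hm : m ∈ U
  · have hI := ind_b σ h0 hσ hU hm
    have hcd := Finset.card_erase_of_mem hm
    have hz' := hz _ hI (by omega)
    have ha : m ∉ U.erase m := by simp
    have := con_dd σ h0 hσ (lft σ m z) ha
    have e1 : lft σ m z (U.erase m) = 0 := by simp [lft]
    have e2 : dd σ (con σ m (lft σ m z)) (U.erase m) = dd σ z (U.erase m) := by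
      refine dd_congr σ fun s hs => ?_
      have := h0 ((U.erase m).erase s) m
      have : m ∉ (U.erase m).erase s := by simp
      simp only [con, lft, Finset.mem_insert_self, if_true, Finset.erase_insert this]
      field_simp
    rw [e1, e2, hz', con, Finset.insert_erase hm] at this
    have h := h0 (U.erase m) m
    simpa [h] using this
  · exact Finset.sum_eq_zero fun s hs => by simp [lft, hm]

lemma inj0 {m i : ℕ} {x : Finset ℕ → K} (hx : Cocyc σ (m + 2) i x)
    (hr : ∀ T, Ind (m - 1) T → T.card + 1 = i → rho σ m x T = 0) : Cobd σ (m + 2) i x := by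
  classical
  refine ⟨fun T => if m ∈ T ∨ m + 1 ∈ T then 0 else con σ (m + 1) x T, fun U hU hc => ?_⟩
  by_cases ha : m + 1 ∈ U
  · have hm : m ∉ U := fun h => hU.2 m h ha
    obtain ⟨T, hT, rfl⟩ : ∃ T, m + 1 ∉ T ∧ insert (m + 1) T = U :=
      ⟨U.erase (m + 1), by simp, Finset.insert_erase ha⟩
    have hmT : m ∉ T := fun h => hm (Finset.mem_insert_of_mem h)
    rw [dd_insert _ _ hT, Finset.sum_eq_zero]
    · have := h0 T (m + 1)
      simp [hT, hmT, con]
      field_simp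
    · intro s hs; simp
  · by_cases hm : m ∈ U
    · have hI := ind_b σ h0 hσ hU hm
      have hcd := Finset.card_erase_of_mem hm
      have hp : 0 < U.card := Finset.card_pos.2 ⟨m, hm⟩
      have h := hr _ hI (by omega)
      obtain ⟨T, hT, rfl⟩ : ∃ T, m ∉ T ∧ insert m T = U :=
        ⟨U.erase m, by simp, Finset.insert_erase hm⟩
      have haT : m + 1 ∉ T := fun h => ha (Finset.mem_insert_of_mem h)
      rw [dd_insert _ _ hT, Finset.sum_eq_zero]
      · have h1 := h0 T (m + 1)
        have h2 := h0 T m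
        rw [Finset.erase_insert hT] at h
        simp only [rho, Pi.sub_apply, sub_eq_zero] at h
        simp only [hT, haT, or_self, if_false, add_zero, ← h]
        simp only [con]
        field_simp
      · intro s hs; simp
    · have hlt : ∀ t ∈ U, t + 1 < m + 1 := fun t ht => by
        have := hU.1 t ht
        have : t ≠ m := fun e => hm (e ▸ ht)
        have : t ≠ m + 1 := fun e => ha (e ▸ ht)
        omega
      have hI : Ind m U := ⟨fun t ht => by have := hlt t ht; omega, hU.2⟩
      have := con_dd σ h0 hσ x ha
      rw [con, hx _ (hI.insert (m + 1) (by omega) hlt (by omega))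
        (by rw [Finset.card_insert_of_notMem ha, hc]), mul_zero] at this
      rw [eq_comm, sub_eq_zero] at this
      rw [this]
      refine dd_congr σ fun s hs => ?_
      simp [hm, ha]

lemma dd_dd (x : Finset ℕ → K) (U : Finset ℕ) : dd σ (dd σ x) U = 0 := by
  induction U using Finset.induction_on generalizing x with
  | empty => simp [dd]
  | insert a T ha ih =>
    have h1 := con_dd σ h0 hσ (dd σ x) ha
    have h2 : dd σ (con σ a (dd σ x)) T = dd σ (x - dd σ (con σ a x)) T :=
      dd_congr σ fun s hs => con_dd σ h0 hσ x (by simp [ha])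
    rw [h2, dd_sub, ih, sub_zero, sub_self, con] at h1
    simpa [h0] using h1

lemma inj {m i : ℕ} {x : Finset ℕ → K} (hx : Cocyc σ (m + 2) (i + 1) x)
    (hr : Cobd σ (m - 1) i (rho σ m x)) : Cobd σ (m + 2) (i + 1) x := by
  obtain ⟨z, hz⟩ := hr
  have := inj0 σ h0 hσ (m := m) (i := i + 1) (x := x + dd σ (lft σ m z)) ?_ ?_
  · obtain ⟨y, hy⟩ := this
    refine ⟨y - lft σ m z, fun U hU hc => ?_⟩
    have := hy U hU hc
    simp only [Pi.add_apply] at this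
    rw [dd_sub, ← this]; ring
  · intro U hU hc
    rw [dd_add, hx U hU hc, dd_dd σ h0 hσ, add_zero]
  · intro T hT hc
    have hlt : ∀ t ∈ T, t < m := fun t ht => by have := hT.1 t ht; omega
    have e : rho σ m (x + dd σ (lft σ m z)) T = rho σ m x T + rho σ m (dd σ (lft σ m z)) T := by
      simp [rho, con]; ring
    rw [e, rho_dd σ h0 hσ _ _ hlt, hz T hT (by omega)]
    rw [dd_congr σ (x := rho σ m (lft σ m z)) (y := z) fun s hs =>
      rho_lft σ h0 hσ m z fun t ht => hlt t (Finset.mem_of_mem_erase ht)]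
    ring

lemma rho_cocyc {m i : ℕ} {x : Finset ℕ → K} (hx : Cocyc σ (m + 2) (i + 1) x) :
    Cocyc σ (m - 1) i (rho σ m x) := by
  intro T hT hc
  have hlt : ∀ t ∈ T, t < m := fun t ht => by have := hT.1 t ht; omega
  have ha : m ∉ T := fun h => by have := hlt _ h; omega
  have hb : m + 1 ∉ T := fun h => by have := hlt _ h; omega
  have h := rho_dd σ h0 hσ m x hlt
  have i1 := hT.insert (m := m + 2) m (by omega) (fun t ht => by have := hT.1 t ht; omega) (by omega)
  have i2 := hT.insert (m := m + 2) (m + 1) (by omega)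
    (fun t ht => by have := hT.1 t ht; omega) (by omega)
  rw [rho, Pi.sub_apply, con, con, hx _ i1 (by rw [Finset.card_insert_of_notMem ha, hc]),
    hx _ i2 (by rw [Finset.card_insert_of_notMem hb, hc])] at h
  simpa using h.symm

lemma rho_cobd {m i : ℕ} {x : Finset ℕ → K} (hx : Cobd σ (m + 2) (i + 1) x) :
    Cobd σ (m - 1) i (rho σ m x) := by
  obtain ⟨y, hy⟩ := hx
  refine ⟨(-1 : K) • rho σ m y, fun T hT hc => ?_⟩
  have hlt : ∀ t ∈ T, t < m := fun t ht => by have := hT.1 t ht; omega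
  have ha : m ∉ T := fun h => by have := hlt _ h; omega
  have hb : m + 1 ∉ T := fun h => by have := hlt _ h; omega
  have i1 := hT.insert (m := m + 2) m (by omega) (fun t ht => by have := hT.1 t ht; omega) (by omega)
  have i2 := hT.insert (m := m + 2) (m + 1) (by omega)
    (fun t ht => by have := hT.1 t ht; omega) (by omega)
  have h := rho_dd σ h0 hσ m y hlt
  rw [dd_smul, neg_one_mul, ← h]
  simp only [rho, Pi.sub_apply, con]
  rw [hy _ i1 (by rw [Finset.card_insert_of_notMem ha, hc]),
    hy _ i2 (by rw [Finset.card_insert_of_notMem hb, hc])]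

lemma acyc_step {m i : ℕ} (h : Acyc σ (m - 1) i) : Acyc σ (m + 2) (i + 1) :=
  fun _ hx => inj σ h0 hσ hx (h _ (rho_cocyc σ h0 hσ hx))

lemma one_step {m i : ℕ} (h : OneDim σ (m - 1) i) : OneDim σ (m + 2) (i + 1) := by
  obtain ⟨g, hg, hn, hs⟩ := h
  have key : ∀ T, Ind (m - 1) T → rho σ m (lft σ m g) T = g T := fun T hT =>
    rho_lft σ h0 hσ m g fun t ht => by have := hT.1 t ht; omega
  refine ⟨lft σ m g, lft_cocyc σ h0 hσ hg, fun hb => hn ?_, fun x hx => ?_⟩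
  · obtain ⟨y, hy⟩ := rho_cobd σ h0 hσ hb
    exact ⟨y, fun U hU hc => by rw [← key U hU, hy U hU hc]⟩
  · obtain ⟨c, y, hy⟩ := hs _ (rho_cocyc σ h0 hσ hx)
    refine ⟨c, inj σ h0 hσ ?_ ⟨y, fun T hT hc => ?_⟩⟩
    · intro U hU hc
      rw [dd_sub, dd_smul, hx U hU hc, lft_cocyc σ h0 hσ hg U hU hc]; simp
    · rw [← hy T hT hc]
      have := key T hT
      simp only [Pi.sub_apply, Pi.smul_apply, smul_eq_mul]
      rw [← this]
      simp [rho, con]; ring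

lemma acyc_zero (m : ℕ) : Acyc σ (m + 1) 0 := by
  intro x hx
  refine ⟨0, fun U hU hc => ?_⟩
  obtain rfl := Finset.card_eq_zero.1 hc
  have := hx {0} ⟨by simp, by simp⟩ (by simp)
  simpa [dd, h0] using this

theorem main (m : ℕ) : ∀ i, if m + 1 = 3 * i ∨ m = 3 * i then OneDim σ m i else Acyc σ m i := by
  induction m using Nat.strong_induction_on with
  | _ m ih =>
  intro i
  match m, i with
  | 0, 0 =>
    simp only [mul_zero, or_true, if_true]
    refine ⟨1, fun U hU hc => ?_, ?_, fun x hx => ⟨x ∅, 0, fun U hU hc => ?_⟩⟩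
    · obtain ⟨t, ht⟩ : U.Nonempty := Finset.card_pos.1 (by omega)
      exact absurd (hU.1 t ht) (by omega)
    · rintro ⟨y, hy⟩
      simpa [dd] using hy ∅ ⟨by simp, by simp⟩ rfl
    · obtain rfl := Finset.card_eq_zero.1 hc
      simp [dd]
  | 0, i + 1 =>
    rw [if_neg (by omega)]
    refine fun x hx => ⟨0, fun U hU hc => ?_⟩
    obtain ⟨t, ht⟩ : U.Nonempty := Finset.card_pos.1 (by omega)
    exact absurd (hU.1 t ht) (by omega)
  | m + 1, 0 =>
    rw [if_neg (by omega)]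
    exact acyc_zero σ h0 hσ m
  | 1, i + 1 =>
    rw [if_neg (by omega)]
    refine fun x hx => ⟨fun _ => (σ ∅ 0)⁻¹ * x {0}, fun U hU hc => ?_⟩
    have hsub : U ⊆ {0} := fun t ht => by have := hU.1 t ht; simp; omega
    rcases Finset.subset_singleton_iff.1 hsub with rfl | rfl
    · simp at hc
    · simp [dd, h0]
  | m + 2, i + 1 =>
    have := ih (m - 1) (by omega) i
    split_ifs at this ⊢ with h1 h2
    · exact one_step σ h0 hσ this
    · omega
    · omega
    · exact acyc_step σ h0 hσ this

end PathInd

namespace PathInd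

lemma swap_sq (a b : ℕ) (h1 : a ≠ b) (h2 : b + 1 ≠ a) (h3 : a + 1 ≠ b) :
    (Equiv.swap a (a + 1) * Equiv.swap b (b + 1)) ^ 2 = 1 := by
  ext k
  simp only [pow_two, Equiv.Perm.mul_apply, Equiv.swap_apply_def, Equiv.Perm.one_apply]
  split_ifs <;> omega

lemma swap_cube_aux (a : ℕ) :
    (Equiv.swap a (a + 1) * Equiv.swap (a + 1) (a + 1 + 1)) ^ 3 = 1 := by
  generalize hg : Equiv.swap a (a + 1) * Equiv.swap (a + 1) (a + 1 + 1) = g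
  have hv : ∀ k, g k = if k = a then a + 1 else if k = a + 1 then a + 2 else
      if k = a + 2 then a else k := by
    intro k
    rw [← hg]
    simp only [Equiv.Perm.mul_apply, Equiv.swap_apply_def]
    split_ifs <;> omega
  ext k
  have e : (g ^ 3) k = g (g (g k)) := by simp [pow_succ]
  rw [e, Equiv.Perm.one_apply]
  have h1 : g a = a + 1 := by rw [hv]; simp
  have h2 : g (a + 1) = a + 2 := by rw [hv]; simp
  have h3 : g (a + 2) = a := by rw [hv]; simp
  by_cases k1 : k = a
  · subst k1; rw [h1, h2, h3]
  by_cases k2 : k = a + 1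
  · subst k2; rw [h2, h3, h1]
  by_cases k3 : k = a + 2
  · subst k3; rw [h3, h1, h2]
  have h4 : g k = k := by rw [hv]; simp [k1, k2, k3]
  rw [h4, h4, h4]

lemma swap_cube (a b : ℕ) (h : b + 1 = a ∨ a + 1 = b) :
    (Equiv.swap a (a + 1) * Equiv.swap b (b + 1)) ^ 3 = 1 := by
  rcases h with rfl | rfl
  · have h := congrArg (fun p => p⁻¹) (swap_cube_aux b)
    simpa only [← inv_pow, mul_inv_rev, Equiv.swap_inv, inv_one] using h
  · exact swap_cube_aux a

variable {n : ℕ} {W : Type*} [Group W] (cs : CoxeterSystem (CoxeterMatrix.A n) W)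

lemma A_apply (i j : Fin n) : CoxeterMatrix.A n i j = if i = j then 1
      else (if (j : ℕ) + 1 = i ∨ (i : ℕ) + 1 = j then 3 else 2) := rfl

lemma liftable : (CoxeterMatrix.A n).IsLiftable
    (fun i : Fin n => Equiv.swap (i : ℕ) (i + 1)) := by
  intro i j
  rw [A_apply]
  split_ifs with h1 h2
  · subst h1; simp
  · exact swap_cube _ _ h2
  · exact swap_sq _ _ (fun h => h1 (Fin.ext h)) (fun h => h2 (Or.inl h)) (fun h => h2 (Or.inr h))

lemma commute_iff (i j : Fin n) (hij : i ≠ j) :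
    Commute (cs.simple i) (cs.simple j) ↔ ¬ ((j : ℕ) + 1 = i ∨ (i : ℕ) + 1 = j) := by
  constructor
  · intro hc h
    have := hc.map (cs.lift ⟨_, liftable⟩)
    rw [cs.lift_apply_simple, cs.lift_apply_simple] at this
    have e := this.eq
    rcases h with h | h
    · rw [← h] at e
      have := congrArg (fun p : Equiv.Perm ℕ => p (j : ℕ)) e
      simp [Equiv.swap_apply_def] at this
      split_ifs at this <;> omega
    · rw [← h] at e
      have := congrArg (fun p : Equiv.Perm ℕ => p (i : ℕ)) e
      simp [Equiv.swap_apply_def] at this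
      split_ifs at this <;> omega
  · intro h
    have := cs.simple_mul_simple_pow i j
    rw [A_apply, if_neg hij, if_neg h] at this
    have h2 : cs.simple i * cs.simple j = (cs.simple i * cs.simple j)⁻¹ := by
      rw [eq_inv_iff_mul_eq_one, ← pow_two, this]
    rw [mul_inv_rev, cs.inv_simple, cs.inv_simple] at h2
    exact h2

lemma ind_iff (T : Finset (Fin n)) : Indep cs T ↔ Ind n (T.map Fin.valEmbedding) := by
  constructor
  · intro h
    refine ⟨fun t ht => ?_, fun t ht ht' => ?_⟩
    · obtain ⟨a, -, rfl⟩ := Finset.mem_map.1 ht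
      exact a.2
    · obtain ⟨a, ha, rfl⟩ := Finset.mem_map.1 ht
      obtain ⟨b, hb, hab⟩ := Finset.mem_map.1 ht'
      simp only [Fin.valEmbedding_apply] at hab
      have hne : a ≠ b := fun e => by subst e; omega
      exact (commute_iff cs a b hne).1 (h a ha b hb hne) (Or.inr hab.symm)
  · intro h i hi j hj hij
    rw [commute_iff cs i j hij]
    rintro (e | e)
    · exact h.2 j (Finset.mem_map_of_mem _ hj) (by
        have := Finset.mem_map_of_mem Fin.valEmbedding hi
        simpa [← e] using this)
    · exact h.2 i (Finset.mem_map_of_mem _ hi) (by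
        have := Finset.mem_map_of_mem Fin.valEmbedding hj
        simpa [← e] using this)

/-- The order relation on `ℕ` extending the one on `Fin n`. -/
def rel (o : LinearOrder (Fin n)) (s t : ℕ) : Prop :=
  if h : s < n ∧ t < n then o.lt ⟨s, h.1⟩ ⟨t, h.2⟩ else s < t

lemma rel_iff (o : LinearOrder (Fin n)) {s t : ℕ} (hst : s ≠ t) : rel o s t ↔ ¬ rel o t s := by
  unfold rel
  by_cases h : s < n ∧ t < n
  · rw [dif_pos h, dif_pos h.symm]
    have hne : (⟨s, h.1⟩ : Fin n) ≠ ⟨t, h.2⟩ := fun e => hst (by simpa using e)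
    rw [@not_lt _ o]
    exact ⟨@le_of_lt _ o.toPreorder _ _, fun h => @lt_of_le_of_ne _ o.toPartialOrder _ _ h hne⟩
  · rw [dif_neg h, dif_neg (fun h' => h h'.symm)]
    omega

open Classical in
/-- The weights. -/
noncomputable def wt (K : Type*) [Field K] (o : LinearOrder (Fin n)) (T : Finset ℕ) (s : ℕ) : K :=
  2 * (-1) ^ (T.filter (fun t => rel o t s)).card

variable {K : Type*} [Field K] (o : LinearOrder (Fin n))

lemma wt_ne (hK : (2 : K) ≠ 0) (T : Finset ℕ) (s : ℕ) : wt K o T s ≠ 0 := by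
  simp [wt, hK]

lemma wt_anti (T : Finset ℕ) (s t : ℕ) (hs : s ∉ T) (ht : t ∉ T) (hst : s ≠ t) :
    wt K o T s * wt K o (insert s T) t = - (wt K o T t * wt K o (insert t T) s) := by
  classical
  have h := rel_iff o hst
  unfold wt
  rw [Finset.filter_insert, Finset.filter_insert]
  by_cases h1 : rel o s t
  · have h2 := h.1 h1
    rw [if_pos h1, if_neg h2, Finset.card_insert_of_notMem (by simp [hs])]
    ring
  · have h2 : rel o t s := by tauto
    rw [if_neg h1, if_pos h2, Finset.card_insert_of_notMem (by simp [ht])]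
    ring

lemma wt_map (T : Finset (Fin n)) (s : Fin n) :
    wt K o (T.map Fin.valEmbedding) s = 2 * (csgn o T s : K) := by
  classical
  unfold wt csgn
  rw [Finset.filter_map, Finset.card_map]
  push_cast
  congr 2
  congr 1
  ext t
  simp [rel]

variable [DistribMulAction W K] [SMulCommClass W K K]
    (htriv : ∀ (w : W) (a : K), w • a = a)

include htriv

/-- restriction of a function on finsets of `ℕ` to a cochain. -/
def res (k : ℕ) (f : Finset ℕ → K) : Xc cs K K k :=
  fun T => ⟨f (T.1.map Fin.valEmbedding), fun _ _ => htriv _ _⟩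

lemma res_surj (k : ℕ) (x : Xc cs K K k) : ∃ f, res cs htriv k f = x := by
  classical
  refine ⟨fun T => if h : ∃ T' : {T : Finset (Fin n) // Indep cs T ∧ T.card = k},
    T'.1.map Fin.valEmbedding = T then (x h.choose : K) else 0, ?_⟩
  funext T
  apply Subtype.ext
  have h : ∃ T' : {T : Finset (Fin n) // Indep cs T ∧ T.card = k},
    T'.1.map Fin.valEmbedding = T.1.map Fin.valEmbedding := ⟨T, rfl⟩
  have e : h.choose = T := Subtype.ext (Finset.map_injective _ h.choose_spec)
  simp only [res]
  rw [dif_pos h, e]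

lemma res_d (k : ℕ) (f : Finset ℕ → K) :
    Xd cs K K o k (res cs htriv k f) = res cs htriv (k + 1) (dd (wt K o) f) := by
  funext U
  apply Subtype.ext
  simp only [Xd, LinearMap.coe_mk, AddHom.coe_mk, res, dd, Finset.sum_map, htriv]
  rw [← Finset.sum_attach U.1]
  refine Finset.sum_congr rfl fun s _ => ?_
  have : (U.1.map Fin.valEmbedding).erase (Fin.valEmbedding s.1) =
    (U.1.erase s.1).map Fin.valEmbedding := by rw [Finset.map_erase]
  rw [this]
  simp only [Fin.valEmbedding_apply]
  rw [wt_map]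
  simp only [Usub, zsmul_eq_mul]
  ring

lemma res_eq_iff (k : ℕ) (f g : Finset ℕ → K) :
    res cs htriv k f = res cs htriv k g ↔ ∀ U, Ind n U → U.card = k → f U = g U := by
  constructor
  · intro h U hU hc
    obtain ⟨T, rfl⟩ : ∃ T : Finset (Fin n), T.map Fin.valEmbedding = U := by
      refine ⟨U.attachFin hU.1, ?_⟩
      exact Finset.map_valEmbedding_attachFin _
    have := congrFun h ⟨T, (ind_iff cs T).2 hU, by simpa using hc⟩
    exact congrArg Subtype.val this
  · intro h
    funext T
    exact Subtype.ext (h _ ((ind_iff cs _).1 T.2.1) (by simpa using T.2.2))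

lemma mem_Z (k : ℕ) (f : Finset ℕ → K) :
    res cs htriv k f ∈ Zc cs K K o k ↔ Cocyc (wt K o) n k f := by
  rw [Zc, LinearMap.mem_ker, res_d cs o htriv]
  have : (0 : Xc cs K K (k + 1)) = res cs htriv (k + 1) 0 := rfl
  rw [this, res_eq_iff]
  rfl

lemma mem_B (k : ℕ) (f : Finset ℕ → K) :
    res cs htriv k f ∈ Bc cs K K o k ↔ Cobd (wt K o) n k f := by
  cases k with
  | zero =>
    have : (0 : Xc cs K K 0) = res cs htriv 0 0 := rfl
    rw [Bc, Submodule.mem_bot, this, res_eq_iff]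
    constructor
    · intro h
      refine ⟨0, fun U hU hc => ?_⟩
      rw [h U hU hc]; simp [dd]
    · rintro ⟨y, hy⟩ U hU hc
      rw [hy U hU hc]
      obtain rfl := Finset.card_eq_zero.1 hc
      simp [dd]
  | succ k =>
    rw [Bc, LinearMap.mem_range]
    constructor
    · rintro ⟨y, hy⟩
      obtain ⟨y, rfl⟩ := res_surj cs htriv k y
      rw [res_d cs o htriv, eq_comm, res_eq_iff] at hy
      exact ⟨y, hy⟩
    · rintro ⟨y, hy⟩
      refine ⟨res cs htriv k y, ?_⟩
      rw [res_d cs o htriv, eq_comm, res_eq_iff]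
      exact hy

theorem final (hK : (2 : K) ≠ 0) (i : ℕ) :
    Module.finrank K (CoxH cs K K o i) = if n + 1 = 3 * i ∨ n = 3 * i then 1 else 0 := by
  have h := main (wt K o) (wt_ne o hK) (wt_anti o) n i
  split_ifs at h ⊢
  · obtain ⟨g, hg, hn, hs⟩ := h
    have hgZ := (mem_Z cs o htriv i g).2 hg
    refine finrank_eq_one (Submodule.Quotient.mk ⟨_, hgZ⟩) ?_ ?_
    · rw [Ne, Submodule.Quotient.mk_eq_zero, Submodule.mem_comap]
      exact fun h' => hn ((mem_B cs o htriv i g).1 h')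
    · intro w
      obtain ⟨⟨x, hx⟩, rfl⟩ := Submodule.Quotient.mk_surjective _ w
      obtain ⟨x, rfl⟩ := res_surj cs htriv i x
      obtain ⟨c, hc⟩ := hs x ((mem_Z cs o htriv i x).1 hx)
      refine ⟨c, ?_⟩
      rw [← Submodule.Quotient.mk_smul, eq_comm, Submodule.Quotient.eq, Submodule.mem_comap]
      exact (mem_B cs o htriv i _).2 hc
  · have : Subsingleton (CoxH cs K K o i) := by
      rw [Submodule.Quotient.subsingleton_iff, eq_top_iff]
      rintro ⟨x, hx⟩ -
      obtain ⟨x, rfl⟩ := res_surj cs htriv i x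
      rw [Submodule.mem_comap]
      exact (mem_B cs o htriv i x).2 (h x ((mem_Z cs o htriv i x).1 hx))
    exact Module.finrank_zero_of_subsingleton

end PathInd

section Statement

/-- Proposition `no-cycle`: for the Coxeter group of type `Aₙ` (`n ≥ 1`) and a
field `K` of characteristic `≠ 2` with trivial action, `dim_K H^i_C(Aₙ, K) = 1` if
`n ∈ {3i-1, 3i}` and `= 0` otherwise. -/
theorem coxeter_cohomology_typeA_trivial_coefficients
    (n : ℕ) (hn : 1 ≤ n) (K : Type*) [Field K] (hK : (2 : K) ≠ 0)
    {W : Type*} [Group W] (cs : CoxeterSystem (CoxeterMatrix.Aₙ n) W)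
    (o : LinearOrder (Fin n))
    [DistribMulAction W K] [SMulCommClass W K K]
    (htriv : ∀ (w : W) (a : K), w • a = a) (i : ℕ) :
    Module.finrank K (CoxH cs K K o i) = if n + 1 = 3 * i ∨ n = 3 * i then 1 else 0 := by
  exact PathInd.final cs o htriv hK i

end Statement
end
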